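/- For any δ > 0, p ≥ 1, and open annulus A₁ = B_{R₁,r₁} ⊂ ℝ², there exists a constant C = C_{δ,p}(A₁) > 0 with the following property: for every closed annulus A₂ = closure(B_{R₂}) \ B_{r₂} with R₁ − R₂ > δ and r₂ − r₁ ≥ δ (so A₂ ⊂ A₁), and every smooth function ξ : A₁ → ℂ^k, one has ‖ξ‖_{L^p(A₂)} + ‖dξ‖_{L^p(A₂)} ≤ C · ( ‖∂̄ξ‖_{L^p(A₁)} + ‖dξ‖_{L²(A₁)} + ‖ξ‖_{L¹(A₁)} ), with norms taken with respect to the standard metric on ℝ² and the inequality understood in the extended reals. -/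

import Mathlib

open MeasureTheory Real

/-- The open annulus `B_{R,r} = B_R \ closure(B_r)` in `ℂ ≅ ℝ²`. -/
noncomputable def cAnnulus (R r : ℝ) : Set ℂ :=
  Metric.ball 0 R \ closure (Metric.ball 0 r)

/-- The closed annulus `closure(B_R) \ B_r` in `ℂ ≅ ℝ²`. -/
noncomputable def cClosedAnnulus (R r : ℝ) : Set ℂ :=
  Metric.closedBall 0 R \ Metric.ball 0 r

/-- The Cauchy–Riemann operator `∂̄ξ = ½(∂_s ξ + i ∂_t ξ)` for `ξ : ℂ → ℂ^k`,
with `ℝ² ≅ ℂ` via `(s,t) ↦ s + it`. -/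
noncomputable def dbar {k : ℕ} (ξ : ℂ → EuclideanSpace ℂ (Fin k)) (z : ℂ) :
    EuclideanSpace ℂ (Fin k) :=
  ((2 : ℂ)⁻¹) • (fderiv ℝ ξ z 1 + Complex.I • fderiv ℝ ξ z Complex.I)

/-- The standard Gaussian density on `ℂ`. -/
noncomputable def gaussDensity (y : ℂ) : ℝ := (2 * π)⁻¹ * Real.exp (-(1 / 2) * ‖y‖ ^ 2)

/-- A smooth function with compact support. -/
structure IsTest {E : Type*} [NormedAddCommGroup E] [NormedSpace ℝ E] (V : ℂ → E) : Prop where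
  contDiff : ContDiff ℝ (⊤ : ℕ∞) V
  compact : HasCompactSupport V

/-- The derivative of `V` in the direction `e`. -/
noncomputable def dirD {E : Type*} [NormedAddCommGroup E] [NormedSpace ℝ E] (e : ℂ) (V : ℂ → E) :
    ℂ → E := fun x => fderiv ℝ V x e

/-- The heat flow: average of `V` against a Gaussian of variance `t` centred at `x`. -/
noncomputable def heat {E : Type*} [NormedAddCommGroup E] [NormedSpace ℝ E] (V : ℂ → E)
    (t : ℝ) (x : ℂ) : E := ∫ y, gaussDensity y • V (x + √t • y)

/-- An integrable weight on `ℂ`. -/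
noncomputable def decayW (x : ℂ) : ℝ := ((1 + ‖x‖) ^ 4)⁻¹

lemma integrable_decayW : Integrable decayW := by
  have h := integrable_one_add_norm (E := ℂ) (μ := volume) (r := 4) (by
    rw [Complex.finrank_real_complex]; norm_num)
  refine h.congr (Filter.Eventually.of_forall fun x => ?_)
  simp only [decayW]
  rw [Real.rpow_neg (by positivity)]
  norm_cast

lemma gaussDensity_pos (y : ℂ) : 0 < gaussDensity y := by unfold gaussDensity; positivity

lemma gaussDensity_le (y : ℂ) : gaussDensity y ≤ (2 * π)⁻¹ := by
  unfold gaussDensity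
  apply mul_le_of_le_one_right (by positivity)
  apply Real.exp_le_one_iff.2
  nlinarith [sq_nonneg ‖y‖]

lemma continuous_gaussDensity : Continuous gaussDensity := by unfold gaussDensity; fun_prop

lemma integral_gaussDensity : ∫ y, gaussDensity y = 1 := by
  unfold gaussDensity
  rw [integral_const_mul]
  have := GaussianFourier.integral_rexp_neg_mul_sq_norm (V := ℂ) (b := 1 / 2) (by norm_num)
  rw [this, Complex.finrank_real_complex]
  norm_num
  field_simp

lemma poly_mul_gauss_integrable (a : ℝ) (ha : 0 ≤ a) (n : ℕ) :
    Integrable fun y : ℂ => gaussDensity y * (1 + a * ‖y‖) ^ n := by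
  have hexp : ∃ C, ∀ s : ℝ, 0 ≤ s → Real.exp (-(1 / 4) * s ^ 2) * (1 + a * s) ^ n ≤ C := by
    refine ⟨n.factorial * Real.exp (1 + a ^ 2), fun s hs => ?_⟩
    have h1 : (1 + a * s) ^ n ≤ n.factorial * Real.exp (1 + a * s) := by
      have := Real.pow_div_factorial_le_exp (1 + a * s) (by positivity) n
      rwa [div_le_iff₀' (by positivity)] at this
    calc _ ≤ Real.exp (-(1 / 4) * s ^ 2) * (n.factorial * Real.exp (1 + a * s)) := by gcongr
      _ = n.factorial * Real.exp (-(1 / 4) * s ^ 2 + (1 + a * s)) := by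
        rw [Real.exp_add (-(1 / 4) * s ^ 2)]; ring
      _ ≤ _ := by
        refine mul_le_mul_of_nonneg_left (Real.exp_le_exp.2 ?_) (by positivity)
        nlinarith [sq_nonneg (s / 2 - a)]
  obtain ⟨C, hC⟩ := hexp
  have hint : Integrable fun y : ℂ => Real.exp (-(1 / 4) * ‖y‖ ^ 2) := by
    have := (GaussianFourier.integrable_cexp_neg_mul_sq_norm_add (V := ℂ) (b := (1 / 4 : ℂ))
      (by norm_num) 0 0).norm
    refine this.congr (Filter.Eventually.of_forall fun y => ?_)
    simp only [Complex.norm_exp]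
    congr 1
    simp [← Complex.ofReal_pow]
  refine ((hint.const_mul ((2 * π)⁻¹ * C))).mono' ?_ (Filter.Eventually.of_forall fun y => ?_)
  · exact (continuous_gaussDensity.mul (by fun_prop)).aestronglyMeasurable
  · have := hC ‖y‖ (norm_nonneg y)
    rw [Real.norm_of_nonneg (mul_nonneg (gaussDensity_pos y).le (by positivity))]
    have e1 : Real.exp (-(1 / 2) * ‖y‖ ^ 2)
        = Real.exp (-(1 / 4) * ‖y‖ ^ 2) * Real.exp (-(1 / 4) * ‖y‖ ^ 2) := by
      rw [← Real.exp_add]; ring_nf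
    unfold gaussDensity
    rw [e1]
    calc _ = (2 * π)⁻¹ * Real.exp (-(1 / 4) * ‖y‖ ^ 2) *
          (Real.exp (-(1 / 4) * ‖y‖ ^ 2) * (1 + a * ‖y‖) ^ n) := by ring
      _ ≤ (2 * π)⁻¹ * Real.exp (-(1 / 4) * ‖y‖ ^ 2) * C := by gcongr
      _ = _ := by ring

lemma integrable_gaussDensity : Integrable gaussDensity := by
  simpa using poly_mul_gauss_integrable 0 le_rfl 0

lemma integrable_norm_mul_gauss : Integrable fun y : ℂ => ‖y‖ * gaussDensity y := by
  refine (poly_mul_gauss_integrable 1 zero_le_one 1).mono'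
    (continuous_norm.mul continuous_gaussDensity).aestronglyMeasurable
    (Filter.Eventually.of_forall fun y => ?_)
  have := (gaussDensity_pos y).le
  rw [Real.norm_of_nonneg (by positivity)]
  nlinarith

lemma hasFDerivAt_gaussDensity (y : ℂ) :
    HasFDerivAt gaussDensity (-(gaussDensity y) • innerSL ℝ y) y := by
  have h1 : HasFDerivAt (fun y : ℂ => ‖y‖ ^ 2) (2 • innerSL ℝ y) y :=
    (hasStrictFDerivAt_norm_sq y).hasFDerivAt
  have h2 := ((h1.const_mul (-(1 / 2) : ℝ)).exp).const_mul ((2 * π)⁻¹)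
  refine h2.congr_fderiv ?_
  ext v
  simp [gaussDensity]
  ring

section
variable {E : Type*} [NormedAddCommGroup E] [NormedSpace ℝ E]

lemma IsTest.dirD {V : ℂ → E} (hV : IsTest V) (e : ℂ) : IsTest (dirD e V) := by
  refine ⟨?_, ?_⟩
  · have : ContDiff ℝ (⊤ : ℕ∞) (fderiv ℝ V) := hV.contDiff.fderiv_right (by simp)
    exact this.clm_apply contDiff_const
  · exact hV.compact.fderiv_apply ℝ e

lemma IsTest.continuous {V : ℂ → E} (hV : IsTest V) : Continuous V := hV.contDiff.continuous

lemma IsTest.differentiable {V : ℂ → E} (hV : IsTest V) : Differentiable ℝ V :=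
  hV.contDiff.differentiable (by simp)

lemma IsTest.fderiv {V : ℂ → E} (hV : IsTest V) : IsTest (fderiv ℝ V) :=
  ⟨hV.contDiff.fderiv_right (by simp), hV.compact.fderiv ℝ⟩

lemma IsTest.exists_bound {V : ℂ → E} (hV : IsTest V) :
    ∃ M, 0 ≤ M ∧ ∀ x, ‖V x‖ ≤ M * decayW x := by
  have hc : Continuous fun x => (1 + ‖x‖) ^ 4 • V x := by
    have := hV.continuous
    fun_prop
  have hs : HasCompactSupport fun x => (1 + ‖x‖) ^ 4 • V x := hV.compact.smul_left
  obtain ⟨M, hM⟩ := hs.exists_bound_of_continuous hc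
  refine ⟨M, (norm_nonneg _).trans (hM 0), fun x => ?_⟩
  have := hM x
  rw [norm_smul, Real.norm_of_nonneg (by positivity)] at this
  unfold decayW
  rw [← div_eq_mul_inv, le_div_iff₀ (by positivity)]
  linarith

lemma IsTest.integrable {V : ℂ → E} (hV : IsTest V) : Integrable V :=
  hV.continuous.integrable_of_hasCompactSupport hV.compact

lemma decayW_add_le (T t : ℝ) (htT : t ≤ T) (x y : ℂ) :
    decayW (x + √t • y) ≤ (1 + √T * ‖y‖) ^ 4 * decayW x := by
  have h1 : 1 + ‖x‖ ≤ (1 + √T * ‖y‖) * (1 + ‖x + √t • y‖) := by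
    have h2 : ‖x‖ ≤ ‖x + √t • y‖ + √t * ‖y‖ := by
      have := norm_sub_le (x + √t • y) (√t • y)
      rwa [add_sub_cancel_right, norm_smul, Real.norm_of_nonneg (Real.sqrt_nonneg t)] at this
    have h3 : √t * ‖y‖ ≤ √T * ‖y‖ := by gcongr
    have h4 : 0 ≤ √T * ‖y‖ * ‖x + √t • y‖ := by positivity
    nlinarith
  unfold decayW
  rw [← div_eq_mul_inv, le_div_iff₀ (by positivity), ← div_eq_inv_mul, div_le_iff₀ (by positivity),
    ← mul_pow]
  gcongr

lemma heat_integrand_bound {V : ℂ → E} {M : ℝ} (hM0 : 0 ≤ M) (hM : ∀ x, ‖V x‖ ≤ M * decayW x)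
    {T t : ℝ} (htT : t ≤ T) (x y : ℂ) :
    ‖gaussDensity y • V (x + √t • y)‖ ≤
      M * decayW x * (gaussDensity y * (1 + √T * ‖y‖) ^ 4) := by
  rw [norm_smul, Real.norm_of_nonneg (gaussDensity_pos y).le]
  have h1 := decayW_add_le T t htT x y
  have := (gaussDensity_pos y).le
  calc _ ≤ gaussDensity y * (M * ((1 + √T * ‖y‖) ^ 4 * decayW x)) := by
        gcongr
        exact (hM _).trans (by gcongr)
    _ = _ := by ring

lemma heat_integrand_integrable {V : ℂ → E} (hV : IsTest V) (t : ℝ) (x : ℂ) :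
    Integrable fun y => gaussDensity y • V (x + √t • y) := by
  obtain ⟨M, hM0, hM⟩ := hV.exists_bound
  refine ((poly_mul_gauss_integrable (√t) (Real.sqrt_nonneg t) 4).const_mul (M * decayW x)).mono'
    ?_ (Filter.Eventually.of_forall fun y => heat_integrand_bound hM0 hM le_rfl x y)
  have := hV.continuous
  have := continuous_gaussDensity
  exact (by fun_prop : Continuous _).aestronglyMeasurable

/-- On bounded time intervals the heat flow of a test function decays uniformly. -/
lemma heat_decay {V : ℂ → E} (hV : IsTest V) (T : ℝ) :
    ∃ C, 0 ≤ C ∧ ∀ t ≤ T, ∀ x, ‖heat V t x‖ ≤ C * decayW x := by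
  obtain ⟨M, hM0, hM⟩ := hV.exists_bound
  refine ⟨M * ∫ y, gaussDensity y * (1 + √T * ‖y‖) ^ 4, ?_, fun t ht x => ?_⟩
  · apply mul_nonneg hM0
    apply integral_nonneg
    intro y
    have := (gaussDensity_pos y).le
    simp only [Pi.zero_apply]; positivity
  · unfold heat
    refine (norm_integral_le_of_norm_le
      ((poly_mul_gauss_integrable (√T) (Real.sqrt_nonneg T) 4).const_mul (M * decayW x))
      (Filter.Eventually.of_forall fun y => heat_integrand_bound hM0 hM ht x y)).trans_eq ?_
    rw [integral_const_mul]; ring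

lemma heat_norm_le {V : ℂ → E} {M : ℝ} (hM : ∀ x, ‖V x‖ ≤ M) (t : ℝ) (x : ℂ) :
    ‖heat V t x‖ ≤ M := by
  unfold heat
  refine (norm_integral_le_of_norm_le (integrable_gaussDensity.mul_const M)
    (Filter.Eventually.of_forall fun y => ?_)).trans_eq ?_
  · rw [norm_smul, Real.norm_of_nonneg (gaussDensity_pos y).le]
    have := (gaussDensity_pos y).le
    gcongr; exact hM _
  · rw [integral_mul_const, integral_gaussDensity, one_mul]

lemma heat_norm_le_div {V : ℂ → E} (hV : IsTest V) {t : ℝ} (ht : 0 < t) (x : ℂ) :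
    ‖heat V t x‖ ≤ (2 * π * t)⁻¹ * ∫ z, ‖V z‖ := by
  have hs : (0:ℝ) < √t := Real.sqrt_pos.2 ht
  have hint : Integrable fun y => ‖V (x + √t • y)‖ := by
    have h1 : Integrable fun z => ‖V (x + z)‖ := (hV.integrable.norm).comp_add_left x
    exact h1.comp_smul hs.ne'
  unfold heat
  refine (norm_integral_le_of_norm_le (hint.const_mul (2 * π)⁻¹)
    (Filter.Eventually.of_forall fun y => ?_)).trans_eq ?_
  · rw [norm_smul, Real.norm_of_nonneg (gaussDensity_pos y).le]
    gcongr; exact gaussDensity_le y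
  · rw [integral_const_mul, Measure.integral_comp_smul volume (fun z => ‖V (x + z)‖) (√t),
      integral_add_left_eq_self (fun z => ‖V z‖) x, Complex.finrank_real_complex,
      Real.sq_sqrt ht.le, abs_of_pos (by positivity), smul_eq_mul]
    field_simp

lemma heat_zero [CompleteSpace E] (V : ℂ → E) (x : ℂ) : heat V 0 x = V x := by
  simp [heat, integral_smul_const, integral_gaussDensity]

lemma heat_continuous_time {V : ℂ → E} (hV : IsTest V) (x : ℂ) :
    Continuous fun t => heat V t x := by
  obtain ⟨M, hM⟩ := hV.compact.exists_bound_of_continuous hV.continuous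
  have := hV.continuous
  have := continuous_gaussDensity
  unfold heat
  refine continuous_of_dominated (bound := fun y => gaussDensity y * M) (fun t => ?_)
    (fun t => Filter.Eventually.of_forall fun y => ?_) (integrable_gaussDensity.mul_const M)
    (Filter.Eventually.of_forall fun y => ?_)
  · exact (by fun_prop : Continuous _).aestronglyMeasurable
  · rw [norm_smul, Real.norm_of_nonneg (gaussDensity_pos y).le]
    have := (gaussDensity_pos y).le
    gcongr; exact hM _
  · fun_prop

lemma heat_hasFDerivAt [CompleteSpace E] {V : ℂ → E} (hV : IsTest V) (t : ℝ) (x : ℂ) :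
    HasFDerivAt (heat V t) (heat (fderiv ℝ V) t x) x := by
  obtain ⟨M, hM⟩ := hV.fderiv.compact.exists_bound_of_continuous hV.fderiv.continuous
  have := hV.continuous
  have := hV.fderiv.continuous
  have := continuous_gaussDensity
  unfold heat
  refine hasFDerivAt_integral_of_dominated_of_fderiv_le (s := Set.univ)
    (F' := fun x y => gaussDensity y • fderiv ℝ V (x + √t • y))
    (bound := fun y => gaussDensity y * M) Filter.univ_mem
    (Filter.Eventually.of_forall fun x => ?_) (heat_integrand_integrable hV t x) ?_
    (Filter.Eventually.of_forall fun y x _ => ?_) (integrable_gaussDensity.mul_const M)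
    (Filter.Eventually.of_forall fun y x _ => ?_)
  · exact (by fun_prop : Continuous _).aestronglyMeasurable
  · exact (heat_integrand_integrable hV.fderiv t x).aestronglyMeasurable
  · rw [norm_smul, Real.norm_of_nonneg (gaussDensity_pos y).le]
    have := (gaussDensity_pos y).le
    gcongr; exact hM _
  · exact (((hV.differentiable (x + √t • y)).hasFDerivAt.comp x
      ((hasFDerivAt_id x).add_const (√t • y)))).const_smul (gaussDensity y)

lemma heat_fderiv_apply [CompleteSpace E] {V : ℂ → E} (hV : IsTest V) (t : ℝ) (x e : ℂ) :
    heat (fderiv ℝ V) t x e = heat (dirD e V) t x := by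
  unfold heat
  rw [ContinuousLinearMap.integral_apply (heat_integrand_integrable hV.fderiv t x)]
  rfl

lemma heat_continuous [CompleteSpace E] {V : ℂ → E} (hV : IsTest V) (t : ℝ) :
    Continuous (heat V t) :=
  continuous_iff_continuousAt.2 fun x => (heat_hasFDerivAt hV t x).continuousAt

lemma heat_hasLineDerivAt [CompleteSpace E] {V : ℂ → E} (hV : IsTest V) (t : ℝ) (x e : ℂ) :
    HasLineDerivAt ℝ (heat V t) (heat (dirD e V) t x) x e := by
  rw [← heat_fderiv_apply hV]
  exact (heat_hasFDerivAt hV t x).hasLineDerivAt e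

lemma heat_integrable [CompleteSpace E] {V : ℂ → E} (hV : IsTest V) (t : ℝ) :
    Integrable (heat V t) := by
  obtain ⟨C, hC0, hC⟩ := heat_decay hV t
  exact (integrable_decayW.const_mul C).mono' (heat_continuous hV t).aestronglyMeasurable
    (Filter.Eventually.of_forall fun x => hC t le_rfl x)

/-- Gaussian integration by parts in one direction. -/
lemma gauss_integration_by_parts [CompleteSpace E] {V : ℂ → E} (hV : IsTest V) (t : ℝ)
    (x e : ℂ) :
    ∫ y, (inner ℝ y e * gaussDensity y) • V (x + √t • y)
      = √t • heat (dirD e V) t x := by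
  have hc := hV.continuous
  have hc' := (hV.dirD e).continuous
  have hg := continuous_gaussDensity
  obtain ⟨M, hM⟩ := hV.compact.exists_bound_of_continuous hV.continuous
  have hi1 : Integrable fun y => (inner ℝ y e * gaussDensity y) • V (x + √t • y) := by
    refine (integrable_norm_mul_gauss.mul_const (‖e‖ * M)).mono'
      (by fun_prop : Continuous _).aestronglyMeasurable (Filter.Eventually.of_forall fun y => ?_)
    rw [norm_smul, norm_mul, Real.norm_of_nonneg (gaussDensity_pos y).le]
    have := (gaussDensity_pos y).le
    calc _ ≤ ‖y‖ * ‖e‖ * gaussDensity y * M := by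
          gcongr
          · exact norm_inner_le_norm y e
          · exact hM _
      _ = _ := by ring
  have key := integral_bilinear_hasLineDerivAt_right_eq_neg_left_of_integrable (μ := volume)
    (B := ContinuousLinearMap.lsmul ℝ ℝ (E := E)) (v := e)
    (f := gaussDensity) (f' := fun y => -(inner ℝ y e * gaussDensity y))
    (g := fun y => V (x + √t • y)) (g' := fun y => √t • dirD e V (x + √t • y))
    (by simpa using hi1.neg)
    (by
      have := (heat_integrand_integrable (hV.dirD e) t x).smul (√t)
      refine this.congr (Filter.Eventually.of_forall fun y => ?_)
      exact smul_comm _ _ _)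
    (by simpa using heat_integrand_integrable hV t x)
    (fun y _ => by
      have := (hasFDerivAt_gaussDensity y).hasLineDerivAt e
      convert this using 1
      simp [mul_comm])
    (fun y _ => by
      have h1 : HasFDerivAt (fun y : ℂ => x + √t • y) (√t • ContinuousLinearMap.id ℝ ℂ) y :=
        ((hasFDerivAt_id y).const_smul (√t)).const_add x
      have h2 := ((hV.differentiable (x + √t • y)).hasFDerivAt.comp y h1).hasLineDerivAt e
      refine h2.congr_deriv ?_
      simp only [dirD, ContinuousLinearMap.comp_apply, smul_apply,
        ContinuousLinearMap.id_apply, map_smul])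
  simp only [ContinuousLinearMap.lsmul_apply, neg_smul, integral_neg, neg_neg] at key
  rw [← key, heat, ← integral_smul]
  congr 1
  ext y
  exact smul_comm _ _ _

/-- The heat equation. -/
lemma heat_hasDerivAt [CompleteSpace E] {V : ℂ → E} (hV : IsTest V) {t : ℝ} (ht : 0 < t) (x : ℂ) :
    HasDerivAt (fun t => heat V t x)
      ((1 / 2 : ℝ) • (heat (dirD 1 (dirD 1 V)) t x +
        heat (dirD Complex.I (dirD Complex.I V)) t x)) t := by
  obtain ⟨M, hM⟩ := hV.fderiv.compact.exists_bound_of_continuous hV.fderiv.continuous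
  have hM0 : 0 ≤ M := (norm_nonneg _).trans (hM 0)
  have hc := hV.continuous
  have hc' := hV.fderiv.continuous
  have hg := continuous_gaussDensity
  have key := hasDerivAt_integral_of_dominated_loc_of_deriv_le (μ := volume)
    (F := fun t y => gaussDensity y • V (x + √t • y)) (x₀ := t) (s := Set.Ioi (t / 2))
    (F' := fun t y => gaussDensity y • fderiv ℝ V (x + √t • y) ((1 / (2 * √t)) • y))
    (bound := fun y => ‖y‖ * gaussDensity y * (M * (1 / (2 * √(t / 2)))))
    (Ioi_mem_nhds (by linarith))
    (Filter.Eventually.of_forall fun s => (by fun_prop : Continuous _).aestronglyMeasurable)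
    (heat_integrand_integrable hV t x) (by fun_prop : Continuous _).aestronglyMeasurable
    (Filter.Eventually.of_forall fun y s hs => by
      have hs' : t / 2 < s := hs
      have h2 : 0 < √(t / 2) := Real.sqrt_pos.2 (by linarith)
      have h3 : √(t / 2) ≤ √s := Real.sqrt_le_sqrt hs'.le
      rw [norm_smul, Real.norm_of_nonneg (gaussDensity_pos y).le]
      have := (gaussDensity_pos y).le
      calc _ ≤ gaussDensity y * (M * ‖(1 / (2 * √s)) • y‖) := by
            gcongr
            exact (ContinuousLinearMap.le_opNorm _ _).trans (by gcongr; exact hM _)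
        _ = ‖y‖ * gaussDensity y * (M * (1 / (2 * √s))) := by
            rw [norm_smul, Real.norm_of_nonneg (by positivity)]; ring
        _ ≤ _ := by gcongr)
    (integrable_norm_mul_gauss.mul_const _)
    (Filter.Eventually.of_forall fun y s hs => by
      have hs' : t / 2 < s := hs
      have h1 : HasDerivAt (fun s : ℝ => x + √s • y) ((1 / (2 * √s)) • y) s :=
        ((Real.hasDerivAt_sqrt (by linarith : s ≠ 0)).smul_const y).const_add x
      exact (((hV.differentiable (x + √s • y)).hasFDerivAt.comp_hasDerivAt s h1)).const_smul _)
  refine key.2.congr_deriv ?_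
  have hs : 0 < √t := Real.sqrt_pos.2 ht
  have e1 := gauss_integration_by_parts (hV.dirD 1) t x 1
  have e2 := gauss_integration_by_parts (hV.dirD Complex.I) t x Complex.I
  have hi (e : ℂ) : Integrable fun y => (inner ℝ y e * gaussDensity y) • dirD e V (x + √t • y) := by
    refine (integrable_norm_mul_gauss.mul_const (‖e‖ * (M * ‖e‖))).mono' ?_
      (Filter.Eventually.of_forall fun y => ?_)
    · have := (hV.dirD e).continuous
      exact (by fun_prop : Continuous _).aestronglyMeasurable
    rw [norm_smul, norm_mul, Real.norm_of_nonneg (gaussDensity_pos y).le]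
    have := (gaussDensity_pos y).le
    calc _ ≤ ‖y‖ * ‖e‖ * gaussDensity y * (M * ‖e‖) := by
          gcongr
          · exact norm_inner_le_norm y e
          · exact (ContinuousLinearMap.le_opNorm _ _).trans (by gcongr; exact hM _)
      _ = _ := by ring
  have e3 : ∀ y : ℂ, gaussDensity y • fderiv ℝ V (x + √t • y) ((1 / (2 * √t)) • y)
      = (1 / (2 * √t)) • ((inner ℝ y 1 * gaussDensity y) • dirD 1 V (x + √t • y)
        + (inner ℝ y Complex.I * gaussDensity y) • dirD Complex.I V (x + √t • y)) := by
    intro y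
    have hy : y = (y.re : ℝ) • (1 : ℂ) + (y.im : ℝ) • Complex.I := by
      apply Complex.ext <;> simp
    have hy2 : fderiv ℝ V (x + √t • y) y = y.re • fderiv ℝ V (x + √t • y) 1
        + y.im • fderiv ℝ V (x + √t • y) Complex.I := by
      conv_lhs => rw [hy]
      rw [map_add, map_smul, map_smul, ← hy]
    rw [map_smul, hy2]
    simp only [dirD, Complex.inner]
    simp [smul_smul, smul_add]
    ring_nf
  simp_rw [e3]
  rw [integral_smul, integral_add (hi 1) (hi Complex.I), e1, e2, ← smul_add, smul_smul]
  congr 1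
  field_simp
end

/-- `φ` is twice continuously differentiable on `[0, ∞)` with derivatives `φ₁`, `φ₂`. -/
structure HasTwoDerivs (φ φ₁ φ₂ : ℝ → ℝ) : Prop where
  hasDerivAt : ∀ s, 0 ≤ s → HasDerivAt φ (φ₁ s) s
  hasDerivAt' : ∀ s, 0 ≤ s → HasDerivAt φ₁ (φ₂ s) s
  continuousOn : ContinuousOn φ₂ (Set.Ici 0)

namespace HasTwoDerivs
variable {φ φ₁ φ₂ : ℝ → ℝ}

lemma continuousOn_zero (h : HasTwoDerivs φ φ₁ φ₂) : ContinuousOn φ (Set.Ici 0) :=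
  fun s hs => (h.hasDerivAt s hs).continuousAt.continuousWithinAt

lemma continuousOn_one (h : HasTwoDerivs φ φ₁ φ₂) : ContinuousOn φ₁ (Set.Ici 0) :=
  fun s hs => (h.hasDerivAt' s hs).continuousAt.continuousWithinAt

lemma exists_bound (h : HasTwoDerivs φ φ₁ φ₂) (S : ℝ) :
    ∃ B, 0 ≤ B ∧ ∀ s, 0 ≤ s → s ≤ S → |φ₁ s| ≤ B ∧ |φ₂ s| ≤ B ∧ |φ s - φ 0| ≤ B * s := by
  have hsub : Set.Icc 0 S ⊆ Set.Ici 0 := fun s hs => hs.1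
  obtain ⟨B1, hB1⟩ := isCompact_Icc.exists_bound_of_continuousOn (h.continuousOn_one.mono hsub)
  obtain ⟨B2, hB2⟩ := isCompact_Icc.exists_bound_of_continuousOn (h.continuousOn.mono hsub)
  have hb1 : ∀ s, 0 ≤ s → s ≤ S → |φ₁ s| ≤ |B1| + |B2| := fun s h0 h1 =>
    ((hB1 s ⟨h0, h1⟩).trans (le_abs_self _)).trans (by linarith [abs_nonneg B2])
  refine ⟨|B1| + |B2|, by positivity, fun s h0 h1 => ⟨hb1 s h0 h1,
    ((hB2 s ⟨h0, h1⟩).trans (le_abs_self _)).trans (by linarith [abs_nonneg B1]), ?_⟩⟩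
  have := Convex.norm_image_sub_le_of_norm_hasDerivWithin_le (f := φ) (f' := φ₁)
    (s := Set.Icc 0 S) (x := 0) (y := s) (C := |B1| + |B2|)
    (fun u hu => (h.hasDerivAt u hu.1).hasDerivWithinAt)
    (fun u hu => hb1 u hu.1 hu.2) (convex_Icc 0 S) ⟨le_rfl, h0.trans h1⟩ ⟨h0, h1⟩
  simpa [abs_of_nonneg h0] using this

end HasTwoDerivs

section
variable {E : Type*} [NormedAddCommGroup E] [InnerProductSpace ℝ E] [CompleteSpace E]
variable {φ φ₁ φ₂ : ℝ → ℝ}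

/-- The dissipation density of the energy `∫ φ(‖V‖²)` in the direction `e`. -/
noncomputable def dissip (φ₁ φ₂ : ℝ → ℝ) (e : ℂ) (V : ℂ → E) (t : ℝ) (x : ℂ) : ℝ :=
  φ₁ (‖heat V t x‖ ^ 2) * ‖heat (dirD e V) t x‖ ^ 2 +
    2 * φ₂ (‖heat V t x‖ ^ 2) * (inner ℝ (heat V t x) (heat (dirD e V) t x)) ^ 2

lemma continuous_comp_heat {ψ : ℝ → ℝ} (hψ : ContinuousOn ψ (Set.Ici 0)) {V : ℂ → E}
    (hV : IsTest V) (t : ℝ) : Continuous fun x => ψ (‖heat V t x‖ ^ 2) := by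
  have := heat_continuous hV t
  exact hψ.comp_continuous (by fun_prop) fun x => by simp only [Set.mem_Ici]; positivity

lemma heat_exists_sup {E : Type*} [NormedAddCommGroup E] [NormedSpace ℝ E] {V : ℂ → E}
    (hV : IsTest V) : ∃ S, 0 ≤ S ∧ ∀ t x, ‖heat V t x‖ ≤ S := by
  obtain ⟨M, hM⟩ := hV.compact.exists_bound_of_continuous hV.continuous
  exact ⟨M, (norm_nonneg _).trans (hM 0), heat_norm_le hM⟩

lemma IsTest.exists_energy_bound {E : Type*} [NormedAddCommGroup E] [InnerProductSpace ℝ E]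
    (h : HasTwoDerivs φ φ₁ φ₂) {V : ℂ → E} (hV : IsTest V) :
    ∃ S B, 0 ≤ S ∧ 0 ≤ B ∧ ∀ t x, ‖heat V t x‖ ≤ S ∧ |φ₁ (‖heat V t x‖ ^ 2)| ≤ B ∧
      |φ₂ (‖heat V t x‖ ^ 2)| ≤ B ∧ |φ (‖heat V t x‖ ^ 2) - φ 0| ≤ B * ‖heat V t x‖ ^ 2 := by
  obtain ⟨S, hS0, hS⟩ := heat_exists_sup hV
  obtain ⟨B, hB0, hB⟩ := h.exists_bound (S ^ 2)
  refine ⟨S, B, hS0, hB0, fun t x => ⟨hS t x, hB _ (by positivity) ?_⟩⟩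
  have := hS t x
  gcongr

lemma dissip_integrable (h : HasTwoDerivs φ φ₁ φ₂) {V : ℂ → E} (hV : IsTest V) (e : ℂ) (t : ℝ) :
    Integrable (dissip φ₁ φ₂ e V t) := by
  obtain ⟨S, B, hS0, hB0, hB⟩ := hV.exists_energy_bound h
  obtain ⟨S', hS0', hS'⟩ := heat_exists_sup (hV.dirD e)
  have c0 := heat_continuous hV t
  have c1 := heat_continuous (hV.dirD e) t
  have c2 := continuous_comp_heat h.continuousOn_one hV t
  have c3 := continuous_comp_heat h.continuousOn hV t
  refine ((heat_integrable (hV.dirD e) t).norm.const_mul (B * S' + 2 * B * (S ^ 2 * S'))).mono'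
    ((c2.mul (c1.norm.pow 2)).add ((continuous_const.mul c3).mul
      ((c0.inner c1).pow 2))).aestronglyMeasurable
    (Filter.Eventually.of_forall fun x => ?_)
  obtain ⟨b0, b1, b2, -⟩ := hB t x
  have b3 := hS' t x
  have b4 : |inner ℝ (heat V t x) (heat (dirD e V) t x)| ≤ S * ‖heat (dirD e V) t x‖ :=
    (abs_real_inner_le_norm _ _).trans (by gcongr)
  have b5 : ‖heat (dirD e V) t x‖ ^ 2 ≤ S' * ‖heat (dirD e V) t x‖ := by
    rw [sq]; gcongr
  unfold dissip
  calc _ ≤ |φ₁ (‖heat V t x‖ ^ 2)| * ‖heat (dirD e V) t x‖ ^ 2 + 2 * |φ₂ (‖heat V t x‖ ^ 2)| *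
        |inner ℝ (heat V t x) (heat (dirD e V) t x)| ^ 2 := by
        refine (norm_add_le _ _).trans_eq ?_
        simp
    _ ≤ B * (S' * ‖heat (dirD e V) t x‖) + 2 * B * (S * ‖heat (dirD e V) t x‖) ^ 2 := by gcongr
    _ = B * (S' * ‖heat (dirD e V) t x‖) + 2 * B * (S ^ 2 * ‖heat (dirD e V) t x‖ ^ 2) := by ring
    _ ≤ B * (S' * ‖heat (dirD e V) t x‖) + 2 * B * (S ^ 2 * (S' * ‖heat (dirD e V) t x‖)) := by
        gcongr
    _ = _ := by ring

lemma heat_smul_inner_integrable {V W : ℂ → E} (hV : IsTest V) (hW : IsTest W)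
    (h : HasTwoDerivs φ φ₁ φ₂) (t : ℝ) :
    Integrable fun x => φ₁ (‖heat V t x‖ ^ 2) * inner ℝ (heat V t x) (heat W t x) := by
  obtain ⟨S, B, hS0, hB0, hB⟩ := hV.exists_energy_bound h
  have c0 := heat_continuous hV t
  have c1 := heat_continuous hW t
  have c2 := continuous_comp_heat h.continuousOn_one hV t
  refine ((heat_integrable hW t).norm.const_mul (B * S)).mono'
    (c2.mul (c0.inner c1)).aestronglyMeasurable
    (Filter.Eventually.of_forall fun x => ?_)
  obtain ⟨b0, b1, -, -⟩ := hB t x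
  rw [norm_mul]
  calc _ ≤ B * (S * ‖heat W t x‖) := by
        gcongr
        · exact b1
        · exact (norm_inner_le_norm _ _).trans (by gcongr)
    _ = _ := by ring

lemma integral_dissip (h : HasTwoDerivs φ φ₁ φ₂) {V : ℂ → E} (hV : IsTest V) (e : ℂ) (t : ℝ) :
    ∫ x, φ₁ (‖heat V t x‖ ^ 2) * inner ℝ (heat V t x) (heat (dirD e (dirD e V)) t x)
      = -∫ x, dissip φ₁ φ₂ e V t x := by
  have e0 : ∀ x, inner ℝ (φ₁ (‖heat V t x‖ ^ 2) • heat (dirD e V) t x +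
      (φ₂ (‖heat V t x‖ ^ 2) * (2 * inner ℝ (heat V t x) (heat (dirD e V) t x))) • heat V t x)
      (heat (dirD e V) t x) = dissip φ₁ φ₂ e V t x := by
    intro x
    rw [inner_add_left, real_inner_smul_left, real_inner_smul_left, real_inner_self_eq_norm_sq]
    unfold dissip
    ring
  have key := integral_bilinear_hasLineDerivAt_right_eq_neg_left_of_integrable (μ := volume)
    (B := innerSL ℝ (E := E)) (v := e)
    (f := fun x => φ₁ (‖heat V t x‖ ^ 2) • heat V t x)
    (f' := fun x => φ₁ (‖heat V t x‖ ^ 2) • heat (dirD e V) t x +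
      (φ₂ (‖heat V t x‖ ^ 2) * (2 * inner ℝ (heat V t x) (heat (dirD e V) t x))) • heat V t x)
    (g := heat (dirD e V) t) (g' := heat (dirD e (dirD e V)) t)
    (by
      refine (dissip_integrable h hV e t).congr (Filter.Eventually.of_forall fun x => ?_)
      exact (e0 x).symm)
    (by
      exact (heat_smul_inner_integrable hV ((hV.dirD e).dirD e) h t).congr
        (Filter.Eventually.of_forall fun x => (real_inner_smul_left _ _ _).symm))
    (by
      exact (heat_smul_inner_integrable hV (hV.dirD e) h t).congr
        (Filter.Eventually.of_forall fun x => (real_inner_smul_left _ _ _).symm))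
    (fun x _ => by
      have h1 : HasDerivAt (fun s : ℝ => heat V t (x + s • e)) (heat (dirD e V) t x) 0 :=
        heat_hasLineDerivAt hV t x e
      have h2 := h1.norm_sq
      have h3 := (h.hasDerivAt' (‖heat V t (x + (0 : ℝ) • e)‖ ^ 2) (by positivity)).comp (0 : ℝ) h2
      have h4 := h3.smul h1
      change HasDerivAt (fun s : ℝ => φ₁ (‖heat V t (x + s • e)‖ ^ 2) • heat V t (x + s • e)) _ 0
      refine h4.congr_deriv ?_
      simp)
    (fun x _ => heat_hasLineDerivAt (hV.dirD e) t x e)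
  have e1 : ∫ x, dissip φ₁ φ₂ e V t x = ∫ x, innerSL ℝ (φ₁ (‖heat V t x‖ ^ 2) •
      heat (dirD e V) t x + (φ₂ (‖heat V t x‖ ^ 2) *
      (2 * inner ℝ (heat V t x) (heat (dirD e V) t x))) • heat V t x) (heat (dirD e V) t x) :=
    integral_congr_ae (Filter.Eventually.of_forall fun x => (e0 x).symm)
  rw [e1, ← key]
  exact integral_congr_ae (Filter.Eventually.of_forall fun x => (real_inner_smul_left _ _ _).symm)

/-- The energy `∫ φ(‖V_t‖²) - φ(0)` along the heat flow. -/
noncomputable def heatEnergy (φ : ℝ → ℝ) (V : ℂ → E) (t : ℝ) : ℝ :=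
  ∫ x, (φ (‖heat V t x‖ ^ 2) - φ 0)

lemma heatEnergy_integrand_bound {E : Type*} [NormedAddCommGroup E] [InnerProductSpace ℝ E]
    (h : HasTwoDerivs φ φ₁ φ₂) {V : ℂ → E} (hV : IsTest V) (T : ℝ) :
    ∃ C, ∀ t ≤ T, ∀ x, ‖φ (‖heat V t x‖ ^ 2) - φ 0‖ ≤ C * decayW x := by
  obtain ⟨S, B, hS0, hB0, hB⟩ := hV.exists_energy_bound h
  obtain ⟨C, hC0, hC⟩ := heat_decay hV T
  refine ⟨B * (S * C), fun t ht x => ?_⟩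
  obtain ⟨b0, -, -, b3⟩ := hB t x
  refine b3.trans ?_
  have := hC t ht x
  have : ‖heat V t x‖ ^ 2 ≤ S * (C * decayW x) := by
    rw [sq]; gcongr
  calc _ ≤ B * (S * (C * decayW x)) := by gcongr
    _ = _ := by ring

lemma heatEnergy_integrand_integrable (h : HasTwoDerivs φ φ₁ φ₂) {V : ℂ → E} (hV : IsTest V)
    (t : ℝ) : Integrable fun x => φ (‖heat V t x‖ ^ 2) - φ 0 := by
  obtain ⟨C, hC⟩ := heatEnergy_integrand_bound h hV t
  exact (integrable_decayW.const_mul C).mono'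
    ((continuous_comp_heat h.continuousOn_zero hV t).sub continuous_const).aestronglyMeasurable
    (Filter.Eventually.of_forall fun x => hC t le_rfl x)

lemma heatEnergy_continuous (h : HasTwoDerivs φ φ₁ φ₂) {V : ℂ → E} (hV : IsTest V) :
    Continuous (heatEnergy φ V) := by
  refine continuous_iff_continuousAt.2 fun t₀ => ?_
  obtain ⟨C, hC⟩ := heatEnergy_integrand_bound h hV (t₀ + 1)
  refine continuousAt_of_dominated (bound := fun x => C * decayW x)
    (Filter.Eventually.of_forall fun t =>
      (heatEnergy_integrand_integrable h hV t).aestronglyMeasurable)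
    ?_ (integrable_decayW.const_mul C) (Filter.Eventually.of_forall fun x => ?_)
  · filter_upwards [Iio_mem_nhds (lt_add_one t₀)] with t ht
    exact Filter.Eventually.of_forall fun x => hC t (le_of_lt ht) x
  · have c := heat_continuous_time hV x
    exact ((h.continuousOn_zero.comp_continuous (f := fun t => ‖heat V t x‖ ^ 2) (by fun_prop)
      fun t => by simp only [Set.mem_Ici]; positivity).sub continuous_const).continuousAt

lemma heatEnergy_hasDerivAt (h : HasTwoDerivs φ φ₁ φ₂) {V : ℂ → E} (hV : IsTest V) {t : ℝ}
    (ht : 0 < t) :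
    HasDerivAt (heatEnergy φ V)
      (-∫ x, (dissip φ₁ φ₂ 1 V t x + dissip φ₁ φ₂ Complex.I V t x)) t := by
  obtain ⟨S, B, hS0, hB0, hB⟩ := hV.exists_energy_bound h
  obtain ⟨C1, hC10, hC1⟩ := heat_decay ((hV.dirD 1).dirD 1) (t + 1)
  obtain ⟨C2, hC20, hC2⟩ := heat_decay ((hV.dirD Complex.I).dirD Complex.I) (t + 1)
  have i1 := heat_smul_inner_integrable hV ((hV.dirD 1).dirD 1) h t
  have i2 := heat_smul_inner_integrable hV ((hV.dirD Complex.I).dirD Complex.I) h t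
  have key := hasDerivAt_integral_of_dominated_loc_of_deriv_le (μ := volume)
    (F := fun t x => φ (‖heat V t x‖ ^ 2) - φ 0) (x₀ := t) (s := Set.Ioo 0 (t + 1))
    (F' := fun t x =>
      φ₁ (‖heat V t x‖ ^ 2) * inner ℝ (heat V t x) (heat (dirD 1 (dirD 1 V)) t x) +
      φ₁ (‖heat V t x‖ ^ 2) *
        inner ℝ (heat V t x) (heat (dirD Complex.I (dirD Complex.I V)) t x))
    (bound := fun x => B * (S * C1) * decayW x + B * (S * C2) * decayW x)
    (Ioo_mem_nhds ht (by linarith))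
    (Filter.Eventually.of_forall fun t =>
      (heatEnergy_integrand_integrable h hV t).aestronglyMeasurable)
    (heatEnergy_integrand_integrable h hV t) (i1.add i2).aestronglyMeasurable
    (Filter.Eventually.of_forall fun x s hs => by
      obtain ⟨b0, b1, -, -⟩ := hB s x
      have b2 := hC1 s hs.2.le x
      have b3 := hC2 s hs.2.le x
      refine (norm_add_le _ _).trans (add_le_add ?_ ?_)
      · rw [norm_mul, mul_assoc, mul_assoc]
        gcongr
        · exact b1
        · exact (norm_inner_le_norm _ _).trans (by gcongr)
      · rw [norm_mul, mul_assoc, mul_assoc]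
        gcongr
        · exact b1
        · exact (norm_inner_le_norm _ _).trans (by gcongr))
    ((integrable_decayW.const_mul _).add (integrable_decayW.const_mul _))
    (Filter.Eventually.of_forall fun x s hs => by
      have h1 := heat_hasDerivAt hV hs.1 x
      have h2 := h1.norm_sq
      have h3 := ((h.hasDerivAt (‖heat V s x‖ ^ 2) (by positivity)).comp s h2).sub_const (φ 0)
      refine h3.congr_deriv ?_
      rw [real_inner_smul_right, inner_add_right]
      ring)
  refine key.2.congr_deriv ?_
  rw [integral_add i1 i2, integral_dissip h hV, integral_dissip h hV,
    integral_add (dissip_integrable h hV _ t) (dissip_integrable h hV _ t)]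
  ring

lemma heat_integral_norm_le {V : ℂ → E} (hV : IsTest V) (t : ℝ) :
    ∫ x, ‖heat V t x‖ ≤ ∫ x, ‖V x‖ := by
  have hc := hV.continuous
  have hg := continuous_gaussDensity
  have hmeas : AEStronglyMeasurable
      (fun z : ℂ × ℂ => gaussDensity z.2 * ‖V (z.1 + √t • z.2)‖) (volume.prod volume) :=
    (by fun_prop : Continuous _).aestronglyMeasurable
  have hint : Integrable (fun z : ℂ × ℂ => gaussDensity z.2 * ‖V (z.1 + √t • z.2)‖)
      (volume.prod volume) := by
    rw [integrable_prod_iff' hmeas]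
    refine ⟨Filter.Eventually.of_forall fun y => ?_, ?_⟩
    · exact ((hV.integrable.norm).comp_add_right (√t • y)).const_mul (gaussDensity y)
    · have : (fun y : ℂ => ∫ x : ℂ, ‖gaussDensity y * ‖V (x + √t • y)‖‖)
          = fun y => gaussDensity y * ∫ x, ‖V x‖ := by
        ext y
        simp only [norm_mul, norm_norm, Real.norm_of_nonneg (gaussDensity_pos y).le]
        rw [integral_const_mul, integral_add_right_eq_self (fun z => ‖V z‖)]
      rw [this]
      exact integrable_gaussDensity.mul_const _
  calc ∫ x, ‖heat V t x‖ ≤ ∫ x, ∫ y, gaussDensity y * ‖V (x + √t • y)‖ := by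
        refine integral_mono (heat_integrable hV t).norm hint.integral_prod_left fun x => ?_
        refine (norm_integral_le_integral_norm _).trans_eq ?_
        congr 1; ext y
        rw [norm_smul, Real.norm_of_nonneg (gaussDensity_pos y).le]
    _ = ∫ y, ∫ x, gaussDensity y * ‖V (x + √t • y)‖ := integral_integral_swap hint
    _ = ∫ y, gaussDensity y * ∫ x, ‖V x‖ := by
        congr 1; ext y
        rw [integral_const_mul, integral_add_right_eq_self (fun z => ‖V z‖)]
    _ = ∫ x, ‖V x‖ := by rw [integral_mul_const, integral_gaussDensity, one_mul]

lemma heatEnergy_tendsto (h : HasTwoDerivs φ φ₁ φ₂) {V : ℂ → E} (hV : IsTest V) :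
    Filter.Tendsto (heatEnergy φ V) Filter.atTop (nhds 0) := by
  obtain ⟨S, B, hS0, hB0, hB⟩ := hV.exists_energy_bound h
  set J := ∫ x, ‖V x‖ with hJ
  have hJ0 : 0 ≤ J := integral_nonneg fun x => norm_nonneg _
  have hlim : Filter.Tendsto (fun t : ℝ => B * ((2 * π)⁻¹ * J * J) * t⁻¹) Filter.atTop
      (nhds 0) := by
    simpa using tendsto_inv_atTop_zero.const_mul (B * ((2 * π)⁻¹ * J * J))
  refine squeeze_zero_norm' ?_ hlim
  filter_upwards [Filter.eventually_gt_atTop 0] with t ht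
  unfold heatEnergy
  refine (norm_integral_le_of_norm_le
    (((heat_integrable hV t).norm).const_mul (B * ((2 * π * t)⁻¹ * J)))
    (Filter.Eventually.of_forall fun x => ?_)).trans ?_
  · refine (hB t x).2.2.2.trans ?_
    rw [sq, mul_assoc]
    gcongr
    exact heat_norm_le_div hV ht x
  · rw [integral_const_mul]
    calc _ ≤ B * ((2 * π * t)⁻¹ * J) * J := by
          gcongr; exact heat_integral_norm_le hV t
      _ = _ := by rw [mul_inv]; ring
end

section
variable {E : Type*} [NormedAddCommGroup E] [NormedSpace ℝ E]

lemma dirD_comm {V : ℂ → E} (hV : IsTest V) (e f : ℂ) : dirD e (dirD f V) = dirD f (dirD e V) := by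
  have key (e f : ℂ) (x : ℂ) : dirD e (dirD f V) x = fderiv ℝ (fderiv ℝ V) x e f := by
    have h := ((hV.fderiv.differentiable x).hasFDerivAt.clm_apply (hasFDerivAt_const f x)).fderiv
    unfold dirD
    rw [h]
    simp
  ext x
  rw [key, key]
  have hs : IsSymmSndFDerivAt ℝ V x := by
    apply hV.contDiff.contDiffAt.isSymmSndFDerivAt
    simp only [minSmoothness_of_isRCLikeNormedField]
    exact WithTop.coe_le_coe.2 (le_top : (2 : ℕ∞) ≤ ⊤)
  exact hs e f

lemma heat_add {V W : ℂ → E} (hV : IsTest V) (hW : IsTest W) (t : ℝ) (x : ℂ) :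
    heat (fun z => V z + W z) t x = heat V t x + heat W t x := by
  unfold heat
  rw [← integral_add (heat_integrand_integrable hV t x) (heat_integrand_integrable hW t x)]
  simp only [smul_add]

lemma heat_clm [CompleteSpace E] {F : Type*} [NormedAddCommGroup F] [NormedSpace ℝ F]
    [CompleteSpace F] (L : E →L[ℝ] F) {V : ℂ → E} (hV : IsTest V) (t : ℝ) (x : ℂ) :
    heat (fun z => L (V z)) t x = L (heat V t x) := by
  unfold heat
  rw [← L.integral_comp_comm (heat_integrand_integrable hV t x)]
  simp only [map_smul]

lemma IsTest.clm {F : Type*} [NormedAddCommGroup F] [NormedSpace ℝ F] (L : E →L[ℝ] F) {V : ℂ → E}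
    (hV : IsTest V) : IsTest fun z => L (V z) :=
  ⟨L.contDiff.comp hV.contDiff, hV.compact.comp_left (g := L) (map_zero L)⟩

lemma IsTest.add {V W : ℂ → E} (hV : IsTest V) (hW : IsTest W) : IsTest fun z => V z + W z :=
  ⟨hV.contDiff.add hW.contDiff, HasCompactSupport.add hV.compact hW.compact⟩

lemma dirD_add {V W : ℂ → E} (hV : IsTest V) (hW : IsTest W) (e x : ℂ) :
    dirD e (fun z => V z + W z) x = dirD e V x + dirD e W x := by
  change fderiv ℝ (V + W) x e = _
  rw [((hV.differentiable x).hasFDerivAt.add (hW.differentiable x).hasFDerivAt).fderiv]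
  rfl

lemma dirD_clm {F : Type*} [NormedAddCommGroup F] [NormedSpace ℝ F] (L : E →L[ℝ] F) {V : ℂ → E}
    (hV : IsTest V) (e x : ℂ) : dirD e (fun z => L (V z)) x = L (dirD e V x) := by
  change fderiv ℝ (L ∘ V) x e = _
  rw [(L.hasFDerivAt.comp x (hV.differentiable x).hasFDerivAt).fderiv]
  rfl
end

/-- Multiplication by a complex number, as a real-linear map. -/
noncomputable abbrev mulCLM (c : ℂ) : ℂ →L[ℝ] ℂ := ContinuousLinearMap.mul ℝ ℂ c

/-- `V ↦ ½(∂₁V + c ∂_I V)`; `c = -I` gives `∂` and `c = I` gives `∂̄`. -/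
noncomputable def wirt (c : ℂ) (V : ℂ → ℂ) (x : ℂ) : ℂ :=
  mulCLM (1 / 2) (dirD 1 V x) + mulCLM (c / 2) (dirD Complex.I V x)

lemma IsTest.wirt {V : ℂ → ℂ} (hV : IsTest V) (c : ℂ) : IsTest (wirt c V) :=
  ((hV.dirD 1).clm _).add ((hV.dirD Complex.I).clm _)

lemma heat_wirt {V : ℂ → ℂ} (hV : IsTest V) (c : ℂ) (t : ℝ) (x : ℂ) :
    heat (wirt c V) t x
      = 1 / 2 * heat (dirD 1 V) t x + c / 2 * heat (dirD Complex.I V) t x := by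
  unfold wirt
  rw [heat_add ((hV.dirD 1).clm _) ((hV.dirD Complex.I).clm _), heat_clm _ (hV.dirD 1),
    heat_clm _ (hV.dirD Complex.I)]
  rfl

lemma wirt_comm {V : ℂ → ℂ} (hV : IsTest V) (c d : ℂ) : wirt c (wirt d V) = wirt d (wirt c V) := by
  have h1 (e d : ℂ) (x : ℂ) : dirD e (wirt d V) x
      = 1 / 2 * dirD e (dirD 1 V) x + d / 2 * dirD e (dirD Complex.I V) x := by
    unfold wirt
    rw [dirD_add ((hV.dirD 1).clm _) ((hV.dirD Complex.I).clm _), dirD_clm _ (hV.dirD 1),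
      dirD_clm _ (hV.dirD Complex.I)]
    rfl
  ext x
  change mulCLM (1 / 2) (dirD 1 (wirt d V) x) + mulCLM (c / 2) (dirD Complex.I (wirt d V) x)
    = mulCLM (1 / 2) (dirD 1 (wirt c V) x) + mulCLM (d / 2) (dirD Complex.I (wirt c V) x)
  rw [h1, h1, h1, h1, dirD_comm hV Complex.I 1]
  simp only [ContinuousLinearMap.mul_apply']
  ring

section
variable {ψ ψ₁ ψ₂ : ℝ → ℝ}

lemma heat_bounded_mul_integrable {χ : ℝ → ℝ} (hχ : ContinuousOn χ (Set.Ici 0)) {h u v : ℂ → ℂ}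
    (hh : IsTest h) (hu : IsTest u) (hv : IsTest v) (c : ℂ) (t : ℝ) :
    Integrable fun x => χ (‖heat h t x‖ ^ 2) * inner ℝ (c * heat u t x) (heat v t x) := by
  obtain ⟨S, hS0, hS⟩ := heat_exists_sup hh
  obtain ⟨U, hU0, hU⟩ := heat_exists_sup hu
  obtain ⟨B, hB⟩ := (isCompact_Icc (a := (0:ℝ)) (b := S ^ 2)).exists_bound_of_continuousOn
    (hχ.mono fun s hs => hs.1)
  have hB0 : 0 ≤ B := (norm_nonneg _).trans (hB 0 ⟨le_rfl, by positivity⟩)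
  refine ((heat_integrable hv t).norm.const_mul (B * (‖c‖ * U))).mono'
    ((continuous_comp_heat hχ hh t).mul ((continuous_const.mul (heat_continuous hu t)).inner
      (heat_continuous hv t))).aestronglyMeasurable (Filter.Eventually.of_forall fun x => ?_)
  rw [norm_mul, mul_assoc]
  have := hS t x
  gcongr
  · exact hB _ ⟨by positivity, by gcongr⟩
  · refine (norm_inner_le_norm _ _).trans ?_
    rw [norm_mul]
    have := hU t x
    gcongr

lemma jacobian_integrable (hψ : HasTwoDerivs ψ ψ₁ ψ₂) {h u : ℂ → ℂ} (hh : IsTest h)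
    (hu : IsTest u) (e : ℂ) (t : ℝ) :
    Integrable fun x => ψ₁ (‖heat h t x‖ ^ 2) *
        (2 * inner ℝ (heat h t x) (heat (dirD e h) t x))
      * inner ℝ (Complex.I * heat h t x) (heat u t x) := by
  have i4 := heat_bounded_mul_integrable hψ.continuousOn_one hh hh (hh.dirD e) 1 t
  obtain ⟨S, hS0, hS⟩ := heat_exists_sup hh
  obtain ⟨U, hU0, hU⟩ := heat_exists_sup hu
  have := (i4.const_mul 2).mul_bdd (c := S * U)
    (g := fun x => inner ℝ (Complex.I * heat h t x) (heat u t x))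
    ((continuous_const.mul (heat_continuous hh t)).inner
      (heat_continuous hu t)).aestronglyMeasurable
    (Filter.Eventually.of_forall fun x => by
      refine (norm_inner_le_norm _ _).trans ?_
      rw [norm_mul, Complex.norm_I, one_mul]
      have := hS t x
      have := hU t x
      gcongr)
  refine this.congr (Filter.Eventually.of_forall fun x => ?_)
  simp only [one_mul]
  ring

lemma jacobian_integral_deriv_eq (hψ : HasTwoDerivs ψ ψ₁ ψ₂) {h u : ℂ → ℂ}
    (hh : IsTest h) (hu : IsTest u) (e : ℂ) (t : ℝ) :
    ∫ x, (ψ (‖heat h t x‖ ^ 2) *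
        inner ℝ (Complex.I * heat (dirD e h) t x) (heat u t x)
      + ψ (‖heat h t x‖ ^ 2) * inner ℝ (Complex.I * heat h t x) (heat (dirD e u) t x))
      = -∫ x, ψ₁ (‖heat h t x‖ ^ 2) * (2 * inner ℝ (heat h t x) (heat (dirD e h) t x))
        * inner ℝ (Complex.I * heat h t x) (heat u t x) := by
  have i1 := heat_bounded_mul_integrable hψ.continuousOn_zero hh (hh.dirD e) hu Complex.I t
  have i2 := heat_bounded_mul_integrable hψ.continuousOn_zero hh hh (hu.dirD e) Complex.I t
  have i3 := heat_bounded_mul_integrable hψ.continuousOn_zero hh hh hu Complex.I t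
  have key := integral_bilinear_hasLineDerivAt_right_eq_neg_left_of_integrable (μ := volume)
    (B := ContinuousLinearMap.mul ℝ ℝ) (v := e)
    (f := fun x => ψ (‖heat h t x‖ ^ 2))
    (f' := fun x => ψ₁ (‖heat h t x‖ ^ 2) * (2 * inner ℝ (heat h t x) (heat (dirD e h) t x)))
    (g := fun x => inner ℝ (Complex.I * heat h t x) (heat u t x))
    (g' := fun x => inner ℝ (Complex.I * heat (dirD e h) t x) (heat u t x)
      + inner ℝ (Complex.I * heat h t x) (heat (dirD e u) t x))
    (jacobian_integrable hψ hh hu e t)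
    (by
      refine (i1.add i2).congr (Filter.Eventually.of_forall fun x => ?_)
      simp only [ContinuousLinearMap.mul_apply', Pi.add_apply]
      ring)
    i3
    (fun x _ => by
      have h1 : HasDerivAt (fun s : ℝ => heat h t (x + s • e)) (heat (dirD e h) t x) 0 :=
        heat_hasLineDerivAt hh t x e
      have h3 := (hψ.hasDerivAt (‖heat h t (x + (0 : ℝ) • e)‖ ^ 2) (by positivity)).comp (0 : ℝ)
        h1.norm_sq
      change HasDerivAt (fun s : ℝ => ψ (‖heat h t (x + s • e)‖ ^ 2)) _ 0
      refine h3.congr_deriv ?_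
      simp)
    (fun x _ => by
      have h1 : HasDerivAt (fun s : ℝ => heat h t (x + s • e)) (heat (dirD e h) t x) 0 :=
        heat_hasLineDerivAt hh t x e
      have h2 : HasDerivAt (fun s : ℝ => heat u t (x + s • e)) (heat (dirD e u) t x) 0 :=
        heat_hasLineDerivAt hu t x e
      have h3 := (h1.const_mul Complex.I).inner ℝ h2
      change HasDerivAt (fun s : ℝ =>
        inner ℝ (Complex.I * heat h t (x + s • e)) (heat u t (x + s • e))) _ 0
      refine h3.congr_deriv ?_
      simp [add_comm])
  simp only [ContinuousLinearMap.mul_apply', mul_add] at key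
  exact key

/-- The Jacobian of the heat flow integrates to zero against radial weights of divergence form. -/
lemma integral_jacobian (hψ : HasTwoDerivs ψ ψ₁ ψ₂) {h : ℂ → ℂ} (hh : IsTest h) (t : ℝ) :
    ∫ x, (ψ (‖heat h t x‖ ^ 2) + ‖heat h t x‖ ^ 2 * ψ₁ (‖heat h t x‖ ^ 2)) *
      inner ℝ (Complex.I * heat (dirD 1 h) t x) (heat (dirD Complex.I h) t x) = 0 := by
  have k1 := jacobian_integral_deriv_eq hψ hh (hh.dirD Complex.I) 1 t
  have k2 := jacobian_integral_deriv_eq hψ hh (hh.dirD 1) Complex.I t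
  have i1 := heat_bounded_mul_integrable hψ.continuousOn_zero hh (hh.dirD 1) (hh.dirD Complex.I)
    Complex.I t
  have i2 := heat_bounded_mul_integrable hψ.continuousOn_zero hh hh
    ((hh.dirD Complex.I).dirD 1) Complex.I t
  have i3 := heat_bounded_mul_integrable hψ.continuousOn_zero hh (hh.dirD Complex.I) (hh.dirD 1)
    Complex.I t
  have i5 := heat_bounded_mul_integrable (χ := fun s => s * ψ₁ s)
    (continuousOn_id.mul hψ.continuousOn_one) hh (hh.dirD 1) (hh.dirD Complex.I) Complex.I t
  rw [dirD_comm hh Complex.I 1] at k2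
  have anti (a b : ℂ) : inner ℝ (Complex.I * a) b = - inner ℝ (Complex.I * b) a := by
    simp [Complex.inner]; ring
  have alg (H a b : ℂ) : inner ℝ H a * inner ℝ (Complex.I * H) b
      - inner ℝ H b * inner ℝ (Complex.I * H) a = ‖H‖ ^ 2 * inner ℝ (Complex.I * a) b := by
    rw [← Complex.normSq_eq_norm_sq]
    simp [Complex.inner, Complex.normSq_apply]; ring
  have j1 := jacobian_integrable hψ hh (hh.dirD Complex.I) 1 t
  have j2 := jacobian_integrable hψ hh (hh.dirD 1) Complex.I t
  have e1 := integral_sub (i1.add i2) (i3.add i2)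
  have e2 := integral_sub j1 j2
  simp only [Pi.add_apply] at e1
  rw [k1, k2] at e1
  have e3 : (∫ x, (ψ (‖heat h t x‖ ^ 2) *
      inner ℝ (Complex.I * heat (dirD 1 h) t x) (heat (dirD Complex.I h) t x)
      + ψ (‖heat h t x‖ ^ 2) * inner ℝ (Complex.I * heat h t x)
        (heat (dirD 1 (dirD Complex.I h)) t x)
      - (ψ (‖heat h t x‖ ^ 2) *
        inner ℝ (Complex.I * heat (dirD Complex.I h) t x) (heat (dirD 1 h) t x)
      + ψ (‖heat h t x‖ ^ 2) * inner ℝ (Complex.I * heat h t x)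
        (heat (dirD 1 (dirD Complex.I h)) t x)))) = 2 * ∫ x, ψ (‖heat h t x‖ ^ 2) *
      inner ℝ (Complex.I * heat (dirD 1 h) t x) (heat (dirD Complex.I h) t x) := by
    rw [← integral_const_mul]
    congr 1
    ext x
    rw [anti (heat (dirD Complex.I h) t x)]
    ring
  have e4 : (∫ x, (ψ₁ (‖heat h t x‖ ^ 2) *
        (2 * inner ℝ (heat h t x) (heat (dirD 1 h) t x))
      * inner ℝ (Complex.I * heat h t x) (heat (dirD Complex.I h) t x)
      - ψ₁ (‖heat h t x‖ ^ 2) *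
        (2 * inner ℝ (heat h t x) (heat (dirD Complex.I h) t x))
      * inner ℝ (Complex.I * heat h t x) (heat (dirD 1 h) t x)))
      = 2 * ∫ x, ‖heat h t x‖ ^ 2 * ψ₁ (‖heat h t x‖ ^ 2) *
      inner ℝ (Complex.I * heat (dirD 1 h) t x) (heat (dirD Complex.I h) t x) := by
    rw [← integral_const_mul]
    congr 1
    ext x
    linear_combination (2 * ψ₁ (‖heat h t x‖ ^ 2)) *
      alg (heat h t x) (heat (dirD 1 h) t x) (heat (dirD Complex.I h) t x)
  simp only [add_mul]
  rw [integral_add i1 i5]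
  linarith [e1, e2, e3, e4]

end

lemma hasTwoDerivs_rpow (m : ℝ) {ε : ℝ} (hε : 0 < ε) :
    HasTwoDerivs (fun s => (s + ε) ^ m) (fun s => m * (s + ε) ^ (m - 1))
      (fun s => m * ((m - 1) * (s + ε) ^ (m - 2))) := by
  have key (m s : ℝ) (hs : 0 ≤ s) :
      HasDerivAt (fun s => (s + ε) ^ m) (m * (s + ε) ^ (m - 1)) s := by
    have := ((hasDerivAt_id s).add_const ε).rpow_const (p := m) (Or.inl (by simp; positivity))
    simpa using this
  refine ⟨fun s hs => key m s hs, fun s hs => ?_, ?_⟩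
  · have := (key (m - 1) s hs).const_mul m
    rwa [show m - 1 - 1 = m - 2 by ring] at this
  · refine continuousOn_const.mul (continuousOn_const.mul ?_)
    exact (continuousOn_id.add continuousOn_const).rpow_const fun s hs =>
      Or.inl (by have : 0 ≤ s := hs; simp; positivity)

section
variable {E : Type*} [NormedAddCommGroup E] [InnerProductSpace ℝ E]

lemma mul_rpow_sub_two_le {m ε s : ℝ} (hε : 0 < ε) (hs : 0 ≤ s) :
    s * (s + ε) ^ (m - 2) ≤ (s + ε) ^ (m - 1) := by
  have h0 : 0 < s + ε := by positivity
  rw [show m - 1 = 1 + (m - 2) by ring, rpow_add h0, rpow_one]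
  have := rpow_pos_of_pos h0 (m - 2)
  gcongr
  linarith

lemma dissip_rpow_le {m ε : ℝ} (hm : 1 ≤ m) (hε : 0 < ε) (V : ℂ → E) (e : ℂ) (t : ℝ) (x : ℂ) :
    dissip (fun s => m * (s + ε) ^ (m - 1)) (fun s => m * ((m - 1) * (s + ε) ^ (m - 2))) e V t x
      ≤ m * (2 * m - 1) * ((‖heat V t x‖ ^ 2 + ε) ^ (m - 1) * ‖heat (dirD e V) t x‖ ^ 2) := by
  unfold dissip
  set H := heat V t x
  set a := heat (dirD e V) t x
  have h0 : 0 < ‖H‖ ^ 2 + ε := by positivity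
  have h1 := mul_rpow_sub_two_le (m := m) hε (sq_nonneg ‖H‖)
  have h2 : (inner ℝ H a) ^ 2 ≤ ‖H‖ ^ 2 * ‖a‖ ^ 2 := by
    rw [← mul_pow]
    exact sq_le_sq' (by linarith [abs_le.1 (abs_real_inner_le_norm H a)]) (real_inner_le_norm H a)
  have h3 := (rpow_pos_of_pos h0 (m - 2)).le
  have h4 : (‖H‖ ^ 2 + ε) ^ (m - 2) * (inner ℝ H a) ^ 2
      ≤ (‖H‖ ^ 2 + ε) ^ (m - 1) * ‖a‖ ^ 2 := by
    calc _ ≤ (‖H‖ ^ 2 + ε) ^ (m - 2) * (‖H‖ ^ 2 * ‖a‖ ^ 2) := by gcongr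
      _ = (‖H‖ ^ 2 * (‖H‖ ^ 2 + ε) ^ (m - 2)) * ‖a‖ ^ 2 := by ring
      _ ≤ _ := by gcongr
  have h5 : 0 ≤ 2 * m * (m - 1) := by nlinarith
  nlinarith [mul_le_mul_of_nonneg_left h4 h5]

lemma le_dissip_rpow {m ε : ℝ} (hm : 1 ≤ m) (hε : 0 < ε) (V : ℂ → E) (e : ℂ) (t : ℝ) (x : ℂ) :
    m * ((‖heat V t x‖ ^ 2 + ε) ^ (m - 1) * ‖heat (dirD e V) t x‖ ^ 2)
      ≤ dissip (fun s => m * (s + ε) ^ (m - 1)) (fun s => m * ((m - 1) * (s + ε) ^ (m - 2)))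
        e V t x := by
  unfold dissip
  have h0 : 0 < ‖heat V t x‖ ^ 2 + ε := by positivity
  have h3 := (rpow_pos_of_pos h0 (m - 2)).le
  have h5 : 0 ≤ m - 1 := by linarith
  have h6 : 0 ≤ 2 * (m * ((m - 1) * (‖heat V t x‖ ^ 2 + ε) ^ (m - 2))) *
    inner ℝ (heat V t x) (heat (dirD e V) t x) ^ 2 := by positivity
  linarith

end

/-- The Hilbert sum `ℂ ⊕ ℂ`. -/
abbrev ComplexPair : Type := WithLp 2 (ℂ × ℂ)

/-- `(h, √K g)` as a map into `ℂ ⊕ ℂ`. -/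
noncomputable def pairMap (K : ℝ) (h g : ℂ → ℂ) (z : ℂ) : ComplexPair :=
  ((WithLp.prodContinuousLinearEquiv 2 ℝ ℂ ℂ).symm.toContinuousLinearMap ∘L
    ContinuousLinearMap.inl ℝ ℂ ℂ) (h z) +
  (√K • (WithLp.prodContinuousLinearEquiv 2 ℝ ℂ ℂ).symm.toContinuousLinearMap ∘L
    ContinuousLinearMap.inr ℝ ℂ ℂ) (g z)

lemma norm_pairMap_sq {K : ℝ} (hK : 0 ≤ K) (h g : ℂ → ℂ) (z : ℂ) :
    ‖pairMap K h g z‖ ^ 2 = ‖h z‖ ^ 2 + K * ‖g z‖ ^ 2 := by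
  rw [WithLp.prod_norm_sq_eq_of_L2]
  simp [pairMap, mul_pow, sq_sqrt hK]

section
variable {h g : ℂ → ℂ}

lemma IsTest.pairMap (hh : IsTest h) (hg : IsTest g) (K : ℝ) : IsTest (pairMap K h g) :=
  (hh.clm _).add (hg.clm _)

lemma heat_pairMap (hh : IsTest h) (hg : IsTest g) (K t : ℝ) :
    heat (pairMap K h g) t = pairMap K (heat h t) (heat g t) := by
  ext1 x
  unfold pairMap
  rw [heat_add (hh.clm _) (hg.clm _), heat_clm _ hh, heat_clm _ hg]

lemma dirD_pairMap (hh : IsTest h) (hg : IsTest g) (K : ℝ) (e : ℂ) :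
    dirD e (pairMap K h g) = pairMap K (dirD e h) (dirD e g) := by
  ext1 x
  unfold pairMap
  rw [dirD_add (hh.clm _) (hg.clm _), dirD_clm _ hh, dirD_clm _ hg]

end

/-- Pointwise comparison of dissipations, up to a null Lagrangian. -/
lemma dissip_le_dissip_pair {m ε K : ℝ} (hm : 1 ≤ m) (hε : 0 < ε) (hK : 0 < K) {h g : ℂ → ℂ}
    (hh : IsTest h) (hg : IsTest g) (hhg : wirt Complex.I h = wirt (-Complex.I) g) (t : ℝ) (x : ℂ) :
    let φ₁ := fun s : ℝ => m * (s + ε) ^ (m - 1)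
    let φ₂ := fun s : ℝ => m * ((m - 1) * (s + ε) ^ (m - 2))
    dissip φ₁ φ₂ 1 h t x + dissip φ₁ φ₂ Complex.I h t x ≤
      ((2 * m - 1) * (m + 1) / K) *
        (dissip φ₁ φ₂ 1 (pairMap K h g) t x + dissip φ₁ φ₂ Complex.I (pairMap K h g) t x) +
      2 * m * (2 * m - 1) * (((‖heat h t x‖ ^ 2 + ε) ^ (m - 1) +
        ‖heat h t x‖ ^ 2 * ((m - 1) * (‖heat h t x‖ ^ 2 + ε) ^ (m - 1 - 1))) *
        inner ℝ (Complex.I * heat (dirD 1 h) t x) (heat (dirD Complex.I h) t x)) := by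
  intro φ₁ φ₂
  have u1 := dissip_rpow_le hm hε h 1 t x
  have u2 := dissip_rpow_le hm hε h Complex.I t x
  have l1 := le_dissip_rpow hm hε (pairMap K h g) 1 t x
  have l2 := le_dissip_rpow hm hε (pairMap K h g) Complex.I t x
  rw [heat_pairMap hh hg, dirD_pairMap hh hg, heat_pairMap (hh.dirD _) (hg.dirD _),
    norm_pairMap_sq hK.le, norm_pairMap_sq hK.le] at l1 l2
  have w1 := heat_wirt hh Complex.I t x
  have w2 := heat_wirt hg (-Complex.I) t x
  rw [hhg, w2] at w1
  set H := heat h t x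
  set G := heat g t x
  set a := heat (dirD 1 h) t x
  set b := heat (dirD Complex.I h) t x
  set c := heat (dirD 1 g) t x
  set d := heat (dirD Complex.I g) t x
  have hHε : 0 < ‖H‖ ^ 2 + ε := by positivity
  set ω₀ := (‖H‖ ^ 2 + ε) ^ (m - 1)
  have hω₀ : 0 < ω₀ := rpow_pos_of_pos hHε _
  have hle : ω₀ ≤ (‖H‖ ^ 2 + K * ‖G‖ ^ 2 + ε) ^ (m - 1) := by
    apply rpow_le_rpow hHε.le _ (by linarith)
    have : 0 ≤ K * ‖G‖ ^ 2 := by positivity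
    linarith
  set ω₁ := (‖H‖ ^ 2 + K * ‖G‖ ^ 2 + ε) ^ (m - 1)
  rw [show m - 1 - 1 = m - 2 by ring]
  have hq := mul_rpow_sub_two_le (m := m) hε (sq_nonneg ‖H‖)
  have hq0 : 0 ≤ ‖H‖ ^ 2 * (‖H‖ ^ 2 + ε) ^ (m - 2) := by positivity
  set θ := ‖H‖ ^ 2 * (‖H‖ ^ 2 + ε) ^ (m - 2)
  set B := ‖1 / 2 * a + Complex.I / 2 * b‖ ^ 2 with hB
  set A := ‖1 / 2 * a - Complex.I / 2 * b‖ ^ 2 with hA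
  have hAB : ‖a‖ ^ 2 + ‖b‖ ^ 2 = 2 * (A + B) := by
    rw [hA, hB]
    simp only [← Complex.normSq_eq_norm_sq, Complex.normSq_apply]
    simp
    ring
  have hJ : inner ℝ (Complex.I * a) b = A - B := by
    rw [hA, hB]
    simp only [← Complex.normSq_eq_norm_sq, Complex.normSq_apply]
    simp [Complex.inner]
    ring
  have hBg : 2 * B ≤ ‖c‖ ^ 2 + ‖d‖ ^ 2 := by
    rw [hB, ← w1]
    simp only [← Complex.normSq_eq_norm_sq, Complex.normSq_apply]
    simp
    nlinarith [sq_nonneg (c.re - d.im), sq_nonneg (c.im + d.re)]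
  have hA0 : 0 ≤ A := by positivity
  have hB0 : 0 ≤ B := by positivity
  have low : 2 * m * K * (ω₀ * B) ≤ dissip φ₁ φ₂ 1 (pairMap K h g) t x +
      dissip φ₁ φ₂ Complex.I (pairMap K h g) t x := by
    refine le_trans ?_ (add_le_add l1 l2)
    calc 2 * m * K * (ω₀ * B) = m * (ω₀ * (K * (2 * B))) := by ring
      _ ≤ m * (ω₁ * (K * (‖c‖ ^ 2 + ‖d‖ ^ 2))) := by gcongr
      _ ≤ m * (ω₁ * (‖a‖ ^ 2 + ‖b‖ ^ 2 + K * (‖c‖ ^ 2 + ‖d‖ ^ 2))) := by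
        have : 0 ≤ ‖a‖ ^ 2 + ‖b‖ ^ 2 := by positivity
        gcongr
        linarith
      _ = _ := by ring
  have hm' : 0 ≤ 2 * m - 1 := by linarith
  have low' : (2 * m - 1) * (m + 1) * (2 * m) * (ω₀ * B) ≤ ((2 * m - 1) * (m + 1) / K) *
      (dissip φ₁ φ₂ 1 (pairMap K h g) t x + dissip φ₁ φ₂ Complex.I (pairMap K h g) t x) := by
    have : 0 ≤ (2 * m - 1) * (m + 1) / K := by positivity
    refine le_trans (le_of_eq ?_) (mul_le_mul_of_nonneg_left low this)
    field_simp
  have hmid : ω₀ * A ≤ m * (ω₀ * B) + (ω₀ + (m - 1) * θ) * (A - B) := by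
    have e1 : 0 ≤ (m - 1) * θ * A := by
      have : 0 ≤ m - 1 := by linarith
      positivity
    have e2 : (m - 1) * θ * B ≤ (m - 1) * ω₀ * B := by
      have : 0 ≤ m - 1 := by linarith
      gcongr
    linarith
  have hup := add_le_add u1 u2
  have : m * (2 * m - 1) * (ω₀ * ‖a‖ ^ 2) + m * (2 * m - 1) * (ω₀ * ‖b‖ ^ 2)
      = 2 * m * (2 * m - 1) * (ω₀ * A + ω₀ * B) := by
    linear_combination m * (2 * m - 1) * ω₀ * hAB
  rw [this] at hup
  refine hup.trans ?_
  have h9 := mul_le_mul_of_nonneg_left hmid (show 0 ≤ 2 * m * (2 * m - 1) by positivity)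
  rw [hJ, show ‖H‖ ^ 2 * ((m - 1) * (‖H‖ ^ 2 + ε) ^ (m - 2)) = (m - 1) * θ by ring]
  linarith

lemma heatEnergy_zero {E : Type*} [NormedAddCommGroup E] [InnerProductSpace ℝ E] [CompleteSpace E]
    (φ : ℝ → ℝ) (V : ℂ → E) : heatEnergy φ V 0 = ∫ x, (φ (‖V x‖ ^ 2) - φ 0) := by
  simp only [heatEnergy, heat_zero]

lemma energy_le_energy_pair {m ε K : ℝ} (hm : 1 ≤ m) (hε : 0 < ε) (hK : 0 < K) {h g : ℂ → ℂ}
    (hh : IsTest h) (hg : IsTest g) (hhg : wirt Complex.I h = wirt (-Complex.I) g) :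
    ∫ x, ((‖h x‖ ^ 2 + ε) ^ m - (0 + ε) ^ m) ≤ ((2 * m - 1) * (m + 1) / K) *
      ∫ x, ((‖h x‖ ^ 2 + K * ‖g x‖ ^ 2 + ε) ^ m - (0 + ε) ^ m) := by
  have hφ := hasTwoDerivs_rpow m hε
  have hψ := hasTwoDerivs_rpow (m - 1) hε
  have hW := hh.pairMap hg K
  set c := (2 * m - 1) * (m + 1) / K
  set φ := fun s : ℝ => (s + ε) ^ m
  set φ₁ := fun s : ℝ => m * (s + ε) ^ (m - 1)
  set φ₂ := fun s : ℝ => m * ((m - 1) * (s + ε) ^ (m - 2))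
  set Ψ := fun t => heatEnergy φ h t - c * heatEnergy φ (pairMap K h g) t
  have hcont : Continuous Ψ :=
    (heatEnergy_continuous hφ hh).sub (continuous_const.mul (heatEnergy_continuous hφ hW))
  have hder (t : ℝ) (ht : 0 < t) := (heatEnergy_hasDerivAt hφ hh ht).sub
    ((heatEnergy_hasDerivAt hφ hW ht).const_mul c)
  have hmono : MonotoneOn Ψ (Set.Ici 0) := by
    refine monotoneOn_of_deriv_nonneg (convex_Ici 0) hcont.continuousOn ?_ ?_
    · rw [interior_Ici]
      exact fun t ht => (hder t ht).differentiableAt.differentiableWithinAt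
    · rw [interior_Ici]
      intro t ht
      have e := (hder t ht).deriv
      change deriv Ψ t = _ at e
      rw [e]
      have i1 := (dissip_integrable hφ hh 1 t).add (dissip_integrable hφ hh Complex.I t)
      have i2 := ((dissip_integrable hφ hW 1 t).add
        (dissip_integrable hφ hW Complex.I t)).const_mul c
      have i3 : Integrable fun x => ((‖heat h t x‖ ^ 2 + ε) ^ (m - 1) +
        ‖heat h t x‖ ^ 2 * ((m - 1) * (‖heat h t x‖ ^ 2 + ε) ^ (m - 1 - 1))) *
        inner ℝ (Complex.I * heat (dirD 1 h) t x) (heat (dirD Complex.I h) t x) :=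
        heat_bounded_mul_integrable (χ := fun s => (s + ε) ^ (m - 1) +
          s * ((m - 1) * (s + ε) ^ (m - 1 - 1))) (hψ.continuousOn_zero.add
          (continuousOn_id.mul hψ.continuousOn_one)) hh (hh.dirD 1) (hh.dirD Complex.I) _ t
      have hj := integral_jacobian hψ hh t
      have := integral_mono i1 (i2.add (i3.const_mul (2 * m * (2 * m - 1))))
        (fun x => dissip_le_dissip_pair hm hε hK hh hg hhg t x)
      simp only [Pi.add_apply] at this
      rw [integral_add (by simpa only [Pi.add_apply] using i2)
        (i3.const_mul (2 * m * (2 * m - 1))), integral_const_mul, integral_const_mul, hj] at this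
      linarith
  have hlim : Filter.Tendsto Ψ Filter.atTop (nhds 0) := by
    simpa using (heatEnergy_tendsto hφ hh).sub ((heatEnergy_tendsto hφ hW).const_mul c)
  have h0 : Ψ 0 ≤ 0 := by
    refine ge_of_tendsto hlim ?_
    filter_upwards [Filter.eventually_ge_atTop 0] with t ht
    exact hmono (Set.self_mem_Ici) ht ht
  have e1 : Ψ 0 = heatEnergy φ h 0 - c * heatEnergy φ (pairMap K h g) 0 := rfl
  rw [e1, heatEnergy_zero, heatEnergy_zero] at h0
  simp only [norm_pairMap_sq hK.le] at h0
  linarith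

lemma IsTest.integrable_comp {h g : ℂ → ℂ} (hh : IsTest h) (hg : IsTest g) {F : ℂ → ℂ → ℝ}
    (hF : Continuous fun z : ℂ × ℂ => F z.1 z.2) (hF0 : F 0 0 = 0) :
    Integrable fun x => F (h x) (g x) := by
  refine (hF.comp (hh.continuous.prodMk hg.continuous)).integrable_of_hasCompactSupport ?_
  refine HasCompactSupport.intro (hh.compact.isCompact.union hg.compact.isCompact) fun x hx => ?_
  rw [Set.mem_union, not_or] at hx
  simp only [Function.comp_apply, image_eq_zero_of_notMem_tsupport hx.1,
    image_eq_zero_of_notMem_tsupport hx.2, hF0]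

lemma rpow_add_sub_rpow_monotoneOn {m s : ℝ} (hm : 1 ≤ m) (hs : 0 ≤ s) :
    MonotoneOn (fun ε : ℝ => (s + ε) ^ m - ε ^ m) (Set.Ici 0) := by
  have hm0 : 0 ≤ m := by linarith
  have hd (ε : ℝ) : HasDerivAt (fun ε : ℝ => (s + ε) ^ m - ε ^ m)
      (m * (s + ε) ^ (m - 1) - m * ε ^ (m - 1)) ε := by
    have h1 := ((hasDerivAt_id ε).const_add s).rpow_const (p := m) (Or.inr hm)
    have h2 := (hasDerivAt_id ε).rpow_const (p := m) (Or.inr hm)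
    simp only [id, one_mul] at h1 h2
    exact h1.sub h2
  refine monotoneOn_of_deriv_nonneg (convex_Ici 0)
    (fun ε _ => (hd ε).continuousAt.continuousWithinAt)
    (fun ε _ => (hd ε).differentiableAt.differentiableWithinAt) fun ε hε => ?_
  rw [interior_Ici] at hε
  have hε' : 0 < ε := hε
  rw [(hd ε).deriv, sub_nonneg]
  exact mul_le_mul_of_nonneg_left
    (rpow_le_rpow hε'.le (by linarith) (by linarith)) hm0

/-- Scalar `L^p` comparison of the two Wirtinger derivatives. -/
lemma wirt_integral_le {m : ℝ} (hm : 1 ≤ m) {h g : ℂ → ℂ}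
    (hh : IsTest h) (hg : IsTest g) (hhg : wirt Complex.I h = wirt (-Complex.I) g) :
    ∫ x, (‖h x‖ ^ 2) ^ m ≤
      (2 * 2 ^ m * ((2 * m - 1) * (m + 1))) ^ m * ∫ x, (‖g x‖ ^ 2) ^ m := by
  have hm0 : 0 < m := by linarith
  have hm1 : 0 < (2 * m - 1) * (m + 1) := by
    have : 0 < 2 * m - 1 := by linarith
    positivity
  set K := 2 * 2 ^ m * ((2 * m - 1) * (m + 1)) with hKdef
  have h2m : (0 : ℝ) < 2 ^ m := rpow_pos_of_pos two_pos m
  have hK : 0 < K := by positivity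
  set c := (2 * m - 1) * (m + 1) / K with hc
  have hcK : c * 2 ^ m = 1 / 2 := by
    have : (2 * m - 1) * (m + 1) ≠ 0 := hm1.ne'
    rw [hc, hKdef, div_mul_eq_mul_div, div_eq_div_iff (by positivity) (by norm_num)]
    ring
  have hc0 : 0 < c := by positivity
  have ih : Integrable fun x => (‖h x‖ ^ 2) ^ m :=
    hh.integrable_comp hg (F := fun a _ => (‖a‖ ^ 2) ^ m)
      ((by fun_prop : Continuous fun z : ℂ × ℂ => ‖z.1‖ ^ 2).rpow_const
        fun _ => Or.inr hm0.le) (by simp [hm0.ne'])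
  have ig : Integrable fun x => (‖g x‖ ^ 2) ^ m :=
    hh.integrable_comp hg (F := fun _ a => (‖a‖ ^ 2) ^ m)
      ((by fun_prop : Continuous fun z : ℂ × ℂ => ‖z.2‖ ^ 2).rpow_const
        fun _ => Or.inr hm0.le) (by simp [hm0.ne'])
  have iε (ε : ℝ) : Integrable fun x => ((‖h x‖ ^ 2 + K * ‖g x‖ ^ 2 + ε) ^ m - (0 + ε) ^ m) :=
    hh.integrable_comp hg (F := fun a b => ((‖a‖ ^ 2 + K * ‖b‖ ^ 2 + ε) ^ m - (0 + ε) ^ m))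
      (((by fun_prop : Continuous fun z : ℂ × ℂ => ‖z.1‖ ^ 2 + K * ‖z.2‖ ^ 2 + ε).rpow_const
        fun _ => Or.inr hm0.le).sub continuous_const) (by simp)
  have iε' (ε : ℝ) : Integrable fun x => ((‖h x‖ ^ 2 + ε) ^ m - (0 + ε) ^ m) :=
    hh.integrable_comp hg (F := fun a _ => ((‖a‖ ^ 2 + ε) ^ m - (0 + ε) ^ m))
      (((by fun_prop : Continuous fun z : ℂ × ℂ => ‖z.1‖ ^ 2 + ε).rpow_const
        fun _ => Or.inr hm0.le).sub continuous_const) (by simp)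
  have step1 (ε : ℝ) (hε : 0 < ε) : ∫ x, (‖h x‖ ^ 2) ^ m ≤
      c * ∫ x, ((‖h x‖ ^ 2 + K * ‖g x‖ ^ 2 + ε) ^ m - (0 + ε) ^ m) := by
    refine le_trans (integral_mono ih (iε' ε) fun x => ?_)
      (energy_le_energy_pair hm hε hK hh hg hhg)
    have := Real.add_rpow_le_rpow_add (sq_nonneg ‖h x‖) hε.le hm
    simp only [zero_add]
    linarith
  have hlim : Filter.Tendsto (fun ε => c * ∫ x, ((‖h x‖ ^ 2 + K * ‖g x‖ ^ 2 + ε) ^ m - (0 + ε) ^ m))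
      (nhdsWithin 0 (Set.Ioi 0)) (nhds (c * ∫ x, (‖h x‖ ^ 2 + K * ‖g x‖ ^ 2) ^ m)) := by
    refine Filter.Tendsto.const_mul c ?_
    refine tendsto_integral_filter_of_dominated_convergence
      (fun x => (‖h x‖ ^ 2 + K * ‖g x‖ ^ 2 + 1) ^ m - (0 + 1) ^ m)
      (Filter.Eventually.of_forall fun ε => (iε ε).aestronglyMeasurable) ?_ (iε 1) ?_
    · have : ∀ᶠ ε : ℝ in nhdsWithin 0 (Set.Ioi 0), ε < 1 :=
        mem_nhdsWithin_of_mem_nhds (Iio_mem_nhds one_pos)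
      filter_upwards [this, self_mem_nhdsWithin] with ε h1 h0
      refine Filter.Eventually.of_forall fun x => ?_
      have h0' : 0 < ε := h0
      have hs : 0 ≤ ‖h x‖ ^ 2 + K * ‖g x‖ ^ 2 := by positivity
      set s := ‖h x‖ ^ 2 + K * ‖g x‖ ^ 2
      rw [norm_eq_abs, abs_of_nonneg (sub_nonneg.2 (rpow_le_rpow (by linarith) (by linarith)
        hm0.le))]
      have := rpow_add_sub_rpow_monotoneOn hm hs (Set.mem_Ici.2 h0'.le)
        (Set.mem_Ici.2 zero_le_one) h1.le
      simpa using this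
    · refine Filter.Eventually.of_forall fun x => ?_
      have : Continuous fun ε : ℝ => (‖h x‖ ^ 2 + K * ‖g x‖ ^ 2 + ε) ^ m - (0 + ε) ^ m :=
        ((by fun_prop : Continuous fun ε : ℝ => ‖h x‖ ^ 2 + K * ‖g x‖ ^ 2 + ε).rpow_const
          fun _ => Or.inr hm0.le).sub ((by fun_prop : Continuous fun ε : ℝ => 0 + ε).rpow_const
          fun _ => Or.inr hm0.le)
      have h2 := this.tendsto 0
      simp only [add_zero, zero_rpow hm0.ne', sub_zero] at h2
      exact h2.mono_left nhdsWithin_le_nhds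
  have step2 : ∫ x, (‖h x‖ ^ 2) ^ m ≤ c * ∫ x, (‖h x‖ ^ 2 + K * ‖g x‖ ^ 2) ^ m :=
    ge_of_tendsto hlim (by filter_upwards [self_mem_nhdsWithin] with ε hε using step1 ε hε)
  have step3 : ∫ x, (‖h x‖ ^ 2 + K * ‖g x‖ ^ 2) ^ m ≤
      2 ^ m * ((∫ x, (‖h x‖ ^ 2) ^ m) + K ^ m * ∫ x, (‖g x‖ ^ 2) ^ m) := by
    rw [← integral_const_mul (K ^ m), ← integral_add ih (ig.const_mul _), ← integral_const_mul]
    refine integral_mono (by simpa [hm0.ne'] using iε 0)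
      ((ih.add (ig.const_mul _)).const_mul _) fun x => ?_
    have hA : 0 ≤ ‖h x‖ ^ 2 := by positivity
    have hB : 0 ≤ K * ‖g x‖ ^ 2 := by positivity
    rw [← mul_rpow hK.le (by positivity)]
    generalize ‖h x‖ ^ 2 = A at *
    generalize K * ‖g x‖ ^ 2 = B at *
    have hmax : A + B ≤ 2 * max A B := by linarith [le_max_left A B, le_max_right A B]
    calc (A + B) ^ m ≤ (2 * max A B) ^ m := rpow_le_rpow (by positivity) hmax hm0.le
      _ = 2 ^ m * (max A B) ^ m := mul_rpow (by norm_num) (le_max_of_le_left hA)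
      _ ≤ _ := by
        gcongr
        have h1 := rpow_nonneg hA m
        have h2 := rpow_nonneg hB m
        rcases max_choice A B with h | h <;> rw [h] <;> linarith
  have h9 := mul_le_mul_of_nonneg_left step3 hc0.le
  rw [← mul_assoc, hcK] at h9
  linarith

lemma exists_wirt_lintegral_le {p : ℝ} (hp : 2 ≤ p) :
    ∃ C : ℝ, 0 ≤ C ∧ ∀ η : ℂ → ℂ, IsTest η →
      ∫⁻ x, ‖wirt (-Complex.I) η x‖ₑ ^ p ≤
        ENNReal.ofReal C * ∫⁻ x, ‖wirt Complex.I η x‖ₑ ^ p := by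
  have hm : 1 ≤ p / 2 := by linarith
  have hp0 : 0 ≤ p := by linarith
  have hC : 0 ≤ (2 * 2 ^ (p / 2) * ((2 * (p / 2) - 1) * (p / 2 + 1))) ^ (p / 2) := by
    have : 0 ≤ 2 * (p / 2) - 1 := by linarith
    positivity
  refine ⟨_, hC, fun η hη => ?_⟩
  have key := wirt_integral_le hm (hη.wirt (-Complex.I)) (hη.wirt Complex.I)
    (wirt_comm hη _ _)
  have conv (V : ℂ → ℂ) (hV : IsTest V) :
      ∫⁻ x, ‖V x‖ₑ ^ p = ENNReal.ofReal (∫ x, (‖V x‖ ^ 2) ^ (p / 2)) := by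
    have hi : Integrable fun x => (‖V x‖ ^ 2) ^ (p / 2) :=
      hV.integrable_comp hV (F := fun a _ => (‖a‖ ^ 2) ^ (p / 2))
        ((by fun_prop : Continuous fun z : ℂ × ℂ => ‖z.1‖ ^ 2).rpow_const
          fun _ => Or.inr (by linarith)) (by
            have : p / 2 ≠ 0 := by linarith
            simp [this])
    rw [ofReal_integral_eq_lintegral_ofReal hi (Filter.Eventually.of_forall fun x => by positivity)]
    refine lintegral_congr fun x => ?_
    rw [← ofReal_norm, ENNReal.ofReal_rpow_of_nonneg (norm_nonneg _) hp0,
      ← rpow_natCast, ← rpow_mul (norm_nonneg _)]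
    congr 2
    push_cast
    ring
  rw [conv _ (hη.wirt _), conv _ (hη.wirt _), ← ENNReal.ofReal_mul hC]
  exact ENNReal.ofReal_le_ofReal key

/-- Averaging `|⟨a, v⟩|^p` over the unit ball gives a multiple of `‖v‖^p`. -/
lemma exists_average_inner (E : Type*) [NormedAddCommGroup E] [InnerProductSpace ℝ E]
    [FiniteDimensional ℝ E] [MeasurableSpace E] [BorelSpace E] {p : ℝ} (hp : 0 < p) :
    ∃ μ : Measure E, SFinite μ ∧ ∃ κ : ENNReal, κ ≠ 0 ∧ κ ≠ ⊤ ∧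
      ∀ v, ∫⁻ a, ‖inner ℝ a v‖ₑ ^ p ∂μ = κ * ‖v‖ₑ ^ p := by
  rcases subsingleton_or_nontrivial E with hE | hE
  · refine ⟨0, inferInstance, 1, one_ne_zero, ENNReal.one_ne_top, fun v => ?_⟩
    rw [Subsingleton.elim v 0]
    simp [hp]
  let B : Set E := Metric.ball 0 1
  obtain ⟨u, hu⟩ := exists_norm_eq E (zero_le_one' ℝ)
  refine ⟨volume.restrict B, inferInstance, ∫⁻ a in B, ‖inner ℝ a u‖ₑ ^ p, ?_, ?_, ?_⟩
  · have hc : Continuous fun a : E => inner ℝ a u := by fun_prop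
    have hm : Measurable fun a : E => ‖inner ℝ a u‖ₑ ^ p := by fun_prop
    rw [Ne, lintegral_eq_zero_iff hm, Filter.EventuallyEq, ae_restrict_iff' measurableSet_ball,
      ae_iff]
    have hopen : IsOpen (B ∩ {a : E | inner ℝ a u ≠ 0}) :=
      Metric.isOpen_ball.inter (isOpen_ne_fun hc continuous_const)
    have hne : (B ∩ {a : E | inner ℝ a u ≠ 0}).Nonempty := by
      refine ⟨(1 / 2 : ℝ) • u, ?_, ?_⟩
      · simp [B, norm_smul, hu]; norm_num
      · simp [real_inner_smul_left, hu]
    refine ((hopen.measure_pos volume hne).trans_le (measure_mono fun a ha => ?_)).ne'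
    have h2 : inner ℝ a u ≠ 0 := ha.2
    simp only [Set.mem_ofPred_eq, Pi.zero_apply, Classical.not_imp]
    refine ⟨ha.1, fun h => h2 ?_⟩
    simpa [ENNReal.rpow_eq_zero_iff, hp, hp.le.not_gt] using h
  · refine (lt_of_le_of_lt (setLIntegral_mono (g := fun _ => 1) measurable_const fun a ha => ?_)
      (by simpa using measure_ball_lt_top)).ne
    have h1 : ‖inner ℝ a u‖ ≤ 1 := by
      refine (norm_inner_le_norm _ _).trans ?_
      rw [hu, mul_one]
      exact (mem_ball_zero_iff.1 ha).le
    refine ENNReal.rpow_le_one ?_ hp.le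
    rw [← ofReal_norm]
    exact ENNReal.ofReal_le_one.2 h1
  · intro v
    rcases eq_or_ne v 0 with rfl | hv
    · simp [hp]
    have hv' : ‖v‖ ≠ 0 := norm_ne_zero_iff.2 hv
    have hw : ‖‖v‖ • u‖ = ‖v‖ := by simp [norm_smul, hu]
    let R : E ≃ₗᵢ[ℝ] E := (ℝ ∙ (v - ‖v‖ • u))ᗮ.reflection
    have hR : R v = ‖v‖ • u := Submodule.reflection_sub hw.symm
    have hmp : MeasurePreserving R (volume.restrict B) (volume.restrict B) := by
      have := R.measurePreserving.restrict_preimage (s := B) measurableSet_ball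
      have hpre : R ⁻¹' B = B := by ext a; simp [B]
      rwa [hpre] at this
    have e1 : ∫⁻ a in B, ‖inner ℝ a v‖ₑ ^ p = ∫⁻ a in B, ‖inner ℝ (R a) (‖v‖ • u)‖ₑ ^ p := by
      refine lintegral_congr fun a => ?_
      rw [← hR, R.inner_map_map]
    rw [e1, hmp.lintegral_comp (f := fun a => ‖inner ℝ a (‖v‖ • u)‖ₑ ^ p) (by fun_prop),
      ← lintegral_mul_const _ (by fun_prop)]
    refine lintegral_congr fun a => ?_
    rw [real_inner_smul_right, enorm_mul, ENNReal.mul_rpow_of_nonneg _ _ hp.le, enorm_norm,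
      mul_comm]

section
variable {k : ℕ}

/-- The operator `½(∂_s - i ∂_t)` for vector-valued functions. -/
noncomputable def dhol (ξ : ℂ → EuclideanSpace ℂ (Fin k)) (z : ℂ) : EuclideanSpace ℂ (Fin k) :=
  ((2 : ℂ)⁻¹) • (fderiv ℝ ξ z 1 - Complex.I • fderiv ℝ ξ z Complex.I)

lemma exists_dhol_lintegral_le {p : ℝ} (hp : 2 ≤ p) :
    ∃ C : ℝ, 0 ≤ C ∧ ∀ (k : ℕ) (η : ℂ → EuclideanSpace ℂ (Fin k)), IsTest η →
      ∫⁻ x, ‖dhol η x‖ₑ ^ p ≤ ENNReal.ofReal C * ∫⁻ x, ‖dbar η x‖ₑ ^ p := by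
  obtain ⟨C, hC0, hC⟩ := exists_wirt_lintegral_le hp
  have hp0 : 0 < p := by linarith
  refine ⟨C * 2 ^ p * 2, by positivity, fun k η hη => ?_⟩
  borelize (EuclideanSpace ℂ (Fin k))
  obtain ⟨μ, hμ, κ, hκ0, hκt, hκ⟩ := exists_average_inner (EuclideanSpace ℂ (Fin k)) hp0
  have hre (a v : EuclideanSpace ℂ (Fin k)) : inner ℝ a v = (inner ℂ a v).re := by
    simp [PiLp.inner_apply, Complex.inner]
  have hc1 : Continuous (dhol η) := by
    have h1 := (hη.dirD 1).continuous
    have h2 := (hη.dirD Complex.I).continuous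
    exact (h1.sub (h2.const_smul Complex.I)).const_smul (2 : ℂ)⁻¹
  have hc2 : Continuous (dbar η) := by
    have h1 := (hη.dirD 1).continuous
    have h2 := (hη.dirD Complex.I).continuous
    exact (h1.add (h2.const_smul Complex.I)).const_smul (2 : ℂ)⁻¹
  have hsc (a : EuclideanSpace ℂ (Fin k)) :
      ∫⁻ x, ‖inner ℂ a (dhol η x)‖ₑ ^ p ≤
        ENNReal.ofReal C * ∫⁻ x, ‖inner ℂ a (dbar η x)‖ₑ ^ p := by
    let L : EuclideanSpace ℂ (Fin k) →L[ℝ] ℂ := (innerSL ℂ a).restrictScalars ℝ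
    have e1 (x : ℂ) : wirt (-Complex.I) (fun z => L (η z)) x = inner ℂ a (dhol η x) := by
      change _ = inner ℂ a ((2 : ℂ)⁻¹ • (dirD 1 η x - Complex.I • dirD Complex.I η x))
      rw [wirt, dirD_clm L hη, dirD_clm L hη, inner_smul_right, inner_sub_right, inner_smul_right]
      change 1 / 2 * inner ℂ a (dirD 1 η x) + -Complex.I / 2 * inner ℂ a (dirD Complex.I η x) = _
      ring
    have e2 (x : ℂ) : wirt Complex.I (fun z => L (η z)) x = inner ℂ a (dbar η x) := by
      change _ = inner ℂ a ((2 : ℂ)⁻¹ • (dirD 1 η x + Complex.I • dirD Complex.I η x))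
      rw [wirt, dirD_clm L hη, dirD_clm L hη, inner_smul_right, inner_add_right, inner_smul_right]
      change 1 / 2 * inner ℂ a (dirD 1 η x) + Complex.I / 2 * inner ℂ a (dirD Complex.I η x) = _
      ring
    simpa only [e1, e2] using hC (fun z => L (η z)) (hη.clm L)
  have hswap (Q : ℂ → EuclideanSpace ℂ (Fin k)) (hQ : Continuous Q) :
      ∫⁻ x, ∫⁻ a, ‖inner ℂ a (Q x)‖ₑ ^ p ∂μ = ∫⁻ a, (∫⁻ x, ‖inner ℂ a (Q x)‖ₑ ^ p) ∂μ := by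
    refine lintegral_lintegral_swap ?_
    have : Continuous fun z : ℂ × EuclideanSpace ℂ (Fin k) => inner ℂ z.2 (Q z.1) := by fun_prop
    exact (this.measurable.enorm.pow_const p).aemeasurable
  have low (v : EuclideanSpace ℂ (Fin k)) :
      κ * ‖v‖ₑ ^ p ≤ ∫⁻ a, ‖inner ℂ a v‖ₑ ^ p ∂μ := by
    rw [← hκ]
    refine lintegral_mono fun a => ENNReal.rpow_le_rpow ?_ hp0.le
    rw [← ofReal_norm, ← ofReal_norm, hre]
    exact ENNReal.ofReal_le_ofReal (Complex.abs_re_le_norm _)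
  have up (v : EuclideanSpace ℂ (Fin k)) :
      ∫⁻ a, ‖inner ℂ a v‖ₑ ^ p ∂μ ≤ ENNReal.ofReal (2 ^ p * 2) * (κ * ‖v‖ₑ ^ p) := by
    have h2 : ∀ a, ‖inner ℂ a v‖ₑ ^ p ≤ ENNReal.ofReal (2 ^ p) *
        (‖inner ℝ a v‖ₑ ^ p + ‖inner ℝ a (Complex.I • v)‖ₑ ^ p) := by
      intro a
      simp only [← ofReal_norm]
      rw [ENNReal.ofReal_rpow_of_nonneg (norm_nonneg _) hp0.le,
        ENNReal.ofReal_rpow_of_nonneg (norm_nonneg _) hp0.le,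
        ENNReal.ofReal_rpow_of_nonneg (norm_nonneg _) hp0.le,
        ← ENNReal.ofReal_add (by positivity) (by positivity),
        ← ENNReal.ofReal_mul (by positivity)]
      refine ENNReal.ofReal_le_ofReal ?_
      rw [hre, hre, inner_smul_right]
      set z := inner ℂ a v
      have hI : ‖(Complex.I * z).re‖ = |z.im| := by simp
      rw [hI, norm_eq_abs]
      have hz := Complex.norm_le_abs_re_add_abs_im z
      have hmax : ‖z‖ ≤ 2 * max |z.re| |z.im| := by
        linarith [le_max_left |z.re| |z.im|, le_max_right |z.re| |z.im|]
      calc ‖z‖ ^ p ≤ (2 * max |z.re| |z.im|) ^ p := rpow_le_rpow (norm_nonneg _) hmax hp0.le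
        _ = 2 ^ p * (max |z.re| |z.im|) ^ p :=
          mul_rpow (by norm_num) (le_max_of_le_left (abs_nonneg _))
        _ ≤ _ := by
          gcongr
          have h1 := rpow_nonneg (abs_nonneg z.re) p
          have h2 := rpow_nonneg (abs_nonneg z.im) p
          rcases max_choice |z.re| |z.im| with h | h <;> rw [h] <;> linarith
    refine (lintegral_mono h2).trans (le_of_eq ?_)
    have hmeas (w : EuclideanSpace ℂ (Fin k)) :
        Measurable fun a : EuclideanSpace ℂ (Fin k) => ‖inner ℝ a w‖ₑ ^ p := by fun_prop
    have hIv : ‖Complex.I • v‖ₑ = ‖v‖ₑ := by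
      simp only [← ofReal_norm, norm_smul, Complex.norm_I, one_mul]
    rw [lintegral_const_mul' _ _ ENNReal.ofReal_ne_top, lintegral_add_left (hmeas _), hκ, hκ, hIv,
      ENNReal.ofReal_mul (by positivity), ENNReal.ofReal_ofNat, ← two_mul, mul_assoc]
  have hmain : κ * ∫⁻ x, ‖dhol η x‖ₑ ^ p ≤
      κ * (ENNReal.ofReal (C * 2 ^ p * 2) * ∫⁻ x, ‖dbar η x‖ₑ ^ p) := by
    have hm1 : Measurable fun x => ‖dhol η x‖ₑ ^ p := by
      exact hc1.measurable.enorm.pow_const p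
    have hm2 : Measurable fun x => ‖dbar η x‖ₑ ^ p := by
      exact hc2.measurable.enorm.pow_const p
    calc κ * ∫⁻ x, ‖dhol η x‖ₑ ^ p = ∫⁻ x, κ * ‖dhol η x‖ₑ ^ p := (lintegral_const_mul _ hm1).symm
      _ ≤ ∫⁻ x, ∫⁻ a, ‖inner ℂ a (dhol η x)‖ₑ ^ p ∂μ := lintegral_mono fun x => low _
      _ = ∫⁻ a, (∫⁻ x, ‖inner ℂ a (dhol η x)‖ₑ ^ p) ∂μ := hswap _ hc1
      _ ≤ ∫⁻ a, (ENNReal.ofReal C * ∫⁻ x, ‖inner ℂ a (dbar η x)‖ₑ ^ p) ∂μ :=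
        lintegral_mono fun a => hsc a
      _ = ENNReal.ofReal C * ∫⁻ a, (∫⁻ x, ‖inner ℂ a (dbar η x)‖ₑ ^ p) ∂μ :=
        lintegral_const_mul' _ _ ENNReal.ofReal_ne_top
      _ = ENNReal.ofReal C * ∫⁻ x, ∫⁻ a, ‖inner ℂ a (dbar η x)‖ₑ ^ p ∂μ := by rw [hswap _ hc2]
      _ ≤ ENNReal.ofReal C * ∫⁻ x, ENNReal.ofReal (2 ^ p * 2) * (κ * ‖dbar η x‖ₑ ^ p) := by
        gcongr with x
        exact up _
      _ = _ := by
        rw [lintegral_const_mul' _ _ ENNReal.ofReal_ne_top, lintegral_const_mul _ hm2, mul_assoc C,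
          ENNReal.ofReal_mul hC0]
        ring
  exact (ENNReal.mul_le_mul_iff_right hκ0 hκt).1 hmain
end

lemma exists_smooth_cutoff {K U : Set ℂ} (hK : IsCompact K) (hU : IsOpen U) (hKU : K ⊆ U) :
    ∃ χ : ℂ → ℝ, IsTest χ ∧ tsupport χ ⊆ U ∧ (∀ z ∈ K, ∀ᶠ w in nhds z, χ w = 1) ∧
      ∀ z, ‖χ z‖ ≤ 1 := by
  obtain ⟨L, hL, hKL, hLU⟩ := exists_compact_between hK hU hKU
  obtain ⟨f, hf1, hf0, hf⟩ := exists_contMDiffMap_one_nhds_of_subset_interior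
    (n := ⊤) (modelWithCornersSelf ℝ ℂ) hK.isClosed hKL
  have hts : tsupport f ⊆ L := closure_minimal
    (fun x hx => by_contra fun h => hx (hf0 x h)) hL.isClosed
  refine ⟨f, ⟨f.contMDiff.contDiff, hL.of_isClosed_subset (isClosed_tsupport _) hts⟩,
    hts.trans hLU, fun z hz => ?_, fun z => ?_⟩
  · exact Filter.Eventually.filter_mono (nhds_le_nhdsSet hz) hf1
  · rw [norm_eq_abs, abs_of_nonneg (hf z).1]
    exact (hf z).2

section
variable {F : Type*} [NormedAddCommGroup F] [NormedSpace ℝ F] {U : Set ℂ} {χ : ℂ → ℝ} {ξ : ℂ → F}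

lemma IsTest.smul_of_contDiffOn (hχ : IsTest χ) (hU : IsOpen U) (hχU : tsupport χ ⊆ U)
    (hξ : ContDiffOn ℝ (⊤ : ℕ∞) ξ U) : IsTest fun z => χ z • ξ z := by
  refine ⟨contDiff_iff_contDiffAt.2 fun z => ?_, hχ.compact.smul_right⟩
  by_cases hz : z ∈ tsupport χ
  · exact hχ.contDiff.contDiffAt.smul (hξ.contDiffAt (hU.mem_nhds (hχU hz)))
  · refine (contDiffAt_const (c := (0 : F))).congr_of_eventuallyEq ?_
    filter_upwards [(isClosed_tsupport χ).isOpen_compl.mem_nhds hz] with w hw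
    rw [image_eq_zero_of_notMem_tsupport hw, zero_smul]

lemma fderiv_smul_eq_zero {z : ℂ} (hz : z ∉ tsupport χ) :
    fderiv ℝ (fun z => χ z • ξ z) z = 0 := by
  have : (fun z => χ z • ξ z) =ᶠ[nhds z] fun _ => (0 : F) := by
    filter_upwards [(isClosed_tsupport χ).isOpen_compl.mem_nhds hz] with w hw
    rw [image_eq_zero_of_notMem_tsupport hw, zero_smul]
  rw [this.fderiv_eq, fderiv_fun_const]
  rfl

lemma fderiv_smul_of_contDiffOn (hχ : IsTest χ) (hU : IsOpen U)
    (hξ : ContDiffOn ℝ (⊤ : ℕ∞) ξ U) {z : ℂ} (hz : z ∈ U) :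
    fderiv ℝ (fun z => χ z • ξ z) z = χ z • fderiv ℝ ξ z + (fderiv ℝ χ z).smulRight (ξ z) :=
  fderiv_fun_smul (hχ.differentiable z)
    ((hξ.contDiffAt (hU.mem_nhds hz)).differentiableAt (by simp))

lemma eLpNorm_le_of_norm_le_add {F₁ F₂ F₃ : Type*} [NormedAddCommGroup F₁] [NormedAddCommGroup F₂]
    [NormedAddCommGroup F₃] {f : ℂ → F₁} {a : ℂ → F₂} {b : ℂ → F₃} {S : Set ℂ}
    (hS : MeasurableSet S) {M : ℝ} (hM : 0 ≤ M) {q : ENNReal} (hq : 1 ≤ q)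
    (ha : AEStronglyMeasurable a (volume.restrict S))
    (hb : AEStronglyMeasurable b (volume.restrict S))
    (h : ∀ x ∈ S, ‖f x‖ ≤ M * (‖a x‖ + ‖b x‖)) (h0 : ∀ x ∉ S, f x = 0) :
    eLpNorm f q volume ≤ ENNReal.ofReal M *
      (eLpNorm a q (volume.restrict S) + eLpNorm b q (volume.restrict S)) := by
  have hf : f = S.indicator f := by
    ext x
    by_cases hx : x ∈ S
    · simp [hx]
    · simp [hx, h0 x hx]
  rw [hf, eLpNorm_indicator_eq_eLpNorm_restrict hS]
  calc eLpNorm f q (volume.restrict S)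
      ≤ eLpNorm (M • ((fun x => ‖a x‖) + fun x => ‖b x‖)) q (volume.restrict S) := by
        refine eLpNorm_mono_ae_real ((ae_restrict_iff' hS).2 (Filter.Eventually.of_forall ?_))
        simpa using h
    _ = ENNReal.ofReal M * eLpNorm ((fun x => ‖a x‖) + fun x => ‖b x‖) q (volume.restrict S) := by
        rw [eLpNorm_const_smul, Real.enorm_of_nonneg hM]
    _ ≤ _ := by
        gcongr
        refine (eLpNorm_add_le ha.norm hb.norm hq).trans ?_
        rw [eLpNorm_norm, eLpNorm_norm]

lemma aestronglyMeasurable_of_contDiffOn (hU : IsOpen U) (hξ : ContDiffOn ℝ (⊤ : ℕ∞) ξ U)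
    {S : Set ℂ} (hS : IsCompact S) (hSU : S ⊆ U) :
    AEStronglyMeasurable ξ (volume.restrict S) ∧
      AEStronglyMeasurable (fun z => fderiv ℝ ξ z) (volume.restrict S) :=
  ⟨(hξ.continuousOn.mono hSU).aestronglyMeasurable_of_isCompact hS hS.measurableSet,
    ((hξ.continuousOn_fderiv_of_isOpen hU (by simp)).mono
      hSU).aestronglyMeasurable_of_isCompact hS hS.measurableSet⟩

lemma exists_eLpNorm_fderiv_smul_le (hχ : IsTest χ) (hχ1 : ∀ z, ‖χ z‖ ≤ 1) :
    ∃ M : ℝ, 0 ≤ M ∧ ∀ z (F : Type) (_ : NormedAddCommGroup F) (_ : NormedSpace ℝ F)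
      (v : F) (D : ℂ →L[ℝ] F), ‖χ z • D + (fderiv ℝ χ z).smulRight v‖ ≤ M * (‖D‖ + ‖v‖) := by
  obtain ⟨B, hB⟩ := hχ.fderiv.compact.exists_bound_of_continuous hχ.fderiv.continuous
  have hB0 : 0 ≤ B := (norm_nonneg _).trans (hB 0)
  refine ⟨1 + B, by positivity, fun z F _ _ v D => ?_⟩
  refine (norm_add_le _ _).trans ?_
  rw [norm_smul, ContinuousLinearMap.norm_smulRight_apply]
  have h1 : ‖χ z‖ * ‖D‖ ≤ 1 * ‖D‖ := by gcongr; exact hχ1 z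
  have h2 : ‖fderiv ℝ χ z‖ * ‖v‖ ≤ B * ‖v‖ := by gcongr; exact hB z
  nlinarith [norm_nonneg D, norm_nonneg v, mul_nonneg hB0 (norm_nonneg D)]

end

/-- Local Sobolev inequality in the plane. -/
lemma exists_local_sobolev {U K : Set ℂ} (hU : IsOpen U) (hK : IsCompact K) (hKU : K ⊆ U)
    {q r : NNReal} (hq : 1 ≤ q) (hqr : (r : ℝ)⁻¹ = (q : ℝ)⁻¹ - 2⁻¹) :
    ∃ S, IsCompact S ∧ S ⊆ U ∧ ∃ C : ENNReal, C ≠ ⊤ ∧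
      ∀ (k : ℕ) (ξ : ℂ → EuclideanSpace ℂ (Fin k)), ContDiffOn ℝ (⊤ : ℕ∞) ξ U →
        eLpNorm ξ r (volume.restrict K) ≤
          C * (eLpNorm (fun z => fderiv ℝ ξ z) q (volume.restrict S) +
            eLpNorm ξ q (volume.restrict S)) := by
  obtain ⟨χ, hχ, hχU, hχK, hχ1⟩ := exists_smooth_cutoff hK hU hKU
  obtain ⟨M, hM0, hM⟩ := exists_eLpNorm_fderiv_smul_le hχ hχ1
  refine ⟨tsupport χ, hχ.compact, hχU,
    eLpNormLESNormFDerivOfEqInnerConst (volume : Measure ℂ) q * ENNReal.ofReal M,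
    ENNReal.mul_ne_top ENNReal.coe_ne_top ENNReal.ofReal_ne_top, fun k ξ hξ => ?_⟩
  have hη := hχ.smul_of_contDiffOn hU hχU hξ
  obtain ⟨m1, m2⟩ := aestronglyMeasurable_of_contDiffOn hU hξ hχ.compact hχU
  have hd := eLpNorm_le_of_norm_le_add (f := fderiv ℝ fun z => χ z • ξ z) (q := q)
    hχ.compact.measurableSet hM0 (by exact_mod_cast hq) m2 m1
    (fun x hx => by
      rw [fderiv_smul_of_contDiffOn hχ hU hξ (hχU hx)]
      exact hM x _ _ _ _ _) (fun x hx => fderiv_smul_eq_zero hx)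
  have hs := eLpNorm_le_eLpNorm_fderiv_of_eq_inner (volume : Measure ℂ)
    (hη.contDiff.of_le (by exact_mod_cast le_top)) hη.compact hq (p' := r)
    (by simp) (by simpa using hqr)
  calc eLpNorm ξ r (volume.restrict K)
      = eLpNorm (fun z => χ z • ξ z) r (volume.restrict K) := by
        refine eLpNorm_congr_ae ((ae_restrict_iff' hK.measurableSet).2
          (Filter.Eventually.of_forall fun z hz => ?_))
        simp only [(hχK z hz).self_of_nhds, one_smul]
    _ ≤ eLpNorm (fun z => χ z • ξ z) r volume := eLpNorm_mono_measure _ Measure.restrict_le_self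
    _ ≤ _ := hs.trans (by rw [mul_assoc]; gcongr)

lemma exists_eLpNorm_le_of_exponent_le (μ : Measure ℂ) [IsFiniteMeasure μ] {p q : ENNReal}
    (hp : 1 ≤ p) (hpq : p ≤ q) (hq : q ≠ ⊤) : ∃ C : ENNReal, C ≠ ⊤ ∧
      ∀ (F : Type) (_ : NormedAddCommGroup F) (f : ℂ → F), AEStronglyMeasurable f μ →
        eLpNorm f p μ ≤ C * eLpNorm f q μ := by
  refine ⟨μ Set.univ ^ (1 / p.toReal - 1 / q.toReal), ?_, fun F _ f hf => ?_⟩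
  · refine ENNReal.rpow_ne_top_of_nonneg ?_ (measure_ne_top _ _)
    have h0 : 0 < p.toReal :=
      ENNReal.toReal_pos (one_pos.trans_le hp).ne' (ne_top_of_le_ne_top hq hpq)
    rw [sub_nonneg]
    exact one_div_le_one_div_of_le h0 (ENNReal.toReal_mono hq hpq)
  · rw [mul_comm]
    exact eLpNorm_le_eLpNorm_mul_rpow_measure_univ hpq hf

/-- Interior `L^r` bound of a function by the `L²` norm of its derivative and its `L¹` norm. -/
lemma exists_eLpNorm_le_of_fderiv_two {U K : Set ℂ} (hU : IsOpen U) (hK : IsCompact K)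
    (hKU : K ⊆ U) {r : ENNReal} (hr : 1 ≤ r) (hrt : r ≠ ⊤) :
    ∃ C : ENNReal, C ≠ ⊤ ∧
      ∀ (k : ℕ) (ξ : ℂ → EuclideanSpace ℂ (Fin k)), ContDiffOn ℝ (⊤ : ℕ∞) ξ U →
        eLpNorm ξ r (volume.restrict K) ≤
          C * (eLpNorm (fun z => fderiv ℝ ξ z) 2 (volume.restrict U) +
            eLpNorm ξ 1 (volume.restrict U)) := by
  have hfin {S : Set ℂ} (hS : IsCompact S) : IsFiniteMeasure (volume.restrict S) :=
    ⟨by simpa using hS.measure_lt_top⟩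
  set s : NNReal := max 2 r.toNNReal with hs
  have hs2 : (2 : ℝ) ≤ s := by exact_mod_cast le_max_left _ _
  have hrs : r ≤ s := by
    rw [← ENNReal.coe_toNNReal hrt]
    exact_mod_cast le_max_right _ _
  set q : NNReal := 2 * s / (s + 2) with hq
  have hqv : (q : ℝ) = 2 * s / (s + 2) := by simp [hq]
  have hq1 : 1 ≤ q := by
    have : (1 : ℝ) ≤ q := by
      rw [hqv, le_div_iff₀ (by positivity)]
      linarith
    exact_mod_cast this
  have hq2 : q ≤ 2 := by
    have : (q : ℝ) ≤ 2 := by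
      rw [hqv, div_le_iff₀ (by positivity)]
      linarith
    exact_mod_cast this
  have hsq : (s : ℝ)⁻¹ = (q : ℝ)⁻¹ - 2⁻¹ := by
    rw [hqv]
    field_simp
    ring
  obtain ⟨S, hS, hSU, C₁, hC₁, H₁⟩ := exists_local_sobolev hU hK hKU hq1 hsq
  obtain ⟨T, hT, hTU, C₂, hC₂, H₂⟩ := exists_local_sobolev (q := 1) (r := 2) hU hS hSU le_rfl
    (by norm_num)
  have := hfin hK
  have := hfin hS
  have := hfin hT
  obtain ⟨A, hA, HA⟩ := exists_eLpNorm_le_of_exponent_le (volume.restrict K) hr hrs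
    ENNReal.coe_ne_top
  obtain ⟨B, hB, HB⟩ := exists_eLpNorm_le_of_exponent_le (volume.restrict S) (p := q) (q := 2)
    (by exact_mod_cast hq1) (by exact_mod_cast hq2) (by norm_num)
  obtain ⟨D, hD, HD⟩ := exists_eLpNorm_le_of_exponent_le (volume.restrict T) (p := 1) (q := 2)
    le_rfl (by norm_num) (by norm_num)
  refine ⟨A * (C₁ * (B * (1 + C₂ * (D + 1)))), by finiteness, fun k ξ hξ => ?_⟩
  have mK := aestronglyMeasurable_of_contDiffOn hU hξ hK hKU
  have mS := aestronglyMeasurable_of_contDiffOn hU hξ hS hSU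
  have mT := aestronglyMeasurable_of_contDiffOn hU hξ hT hTU
  have h₂ := H₂ k ξ hξ
  simp only [ENNReal.coe_one, ENNReal.coe_ofNat] at h₂
  set X := eLpNorm (fun z => fderiv ℝ ξ z) 2 (volume.restrict U)
  set Y := eLpNorm ξ 1 (volume.restrict U)
  have hX {S : Set ℂ} (h : S ⊆ U) : eLpNorm (fun z => fderiv ℝ ξ z) 2 (volume.restrict S) ≤ X :=
    eLpNorm_mono_measure _ (Measure.restrict_mono h le_rfl)
  have hY {S : Set ℂ} (h : S ⊆ U) : eLpNorm ξ 1 (volume.restrict S) ≤ Y :=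
    eLpNorm_mono_measure _ (Measure.restrict_mono h le_rfl)
  have h₃ : eLpNorm ξ 2 (volume.restrict S) ≤ C₂ * (D + 1) * (X + Y) := by
    refine h₂.trans ?_
    rw [mul_assoc]
    gcongr
    calc _ ≤ D * X + Y := by
          gcongr
          · exact (HD _ _ _ mT.2).trans (by gcongr; exact hX hTU)
          · exact hY hTU
      _ ≤ D * X + Y + (X + D * Y) := le_self_add
      _ = _ := by ring
  calc eLpNorm ξ r (volume.restrict K) ≤ A * eLpNorm ξ s (volume.restrict K) := HA _ _ _ mK.1
    _ ≤ A * (C₁ * (eLpNorm (fun z => fderiv ℝ ξ z) q (volume.restrict S) +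
          eLpNorm ξ q (volume.restrict S))) := by gcongr; exact H₁ k ξ hξ
    _ ≤ A * (C₁ * (B * X + B * (C₂ * (D + 1) * (X + Y)))) := by
        gcongr
        · exact (HB _ _ _ mS.2).trans (by gcongr; exact hX hSU)
        · exact (HB _ _ _ mS.1).trans (by gcongr)
    _ ≤ A * (C₁ * (B * X + B * (C₂ * (D + 1) * (X + Y)))) + A * (C₁ * (B * Y)) := le_self_add
    _ = _ := by ring

section
variable {k : ℕ}

lemma norm_fderiv_le_dhol_add_dbar (ξ : ℂ → EuclideanSpace ℂ (Fin k)) (z : ℂ) :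
    ‖fderiv ℝ ξ z‖ ≤ ‖dhol ξ z‖ + ‖dbar ξ z‖ := by
  refine ContinuousLinearMap.opNorm_le_bound _ (by positivity) fun w => ?_
  have hw : fderiv ℝ ξ z w = w • dhol ξ z + (starRingEnd ℂ w) • dbar ξ z := by
    have h1 : fderiv ℝ ξ z w
        = (w.re : ℂ) • fderiv ℝ ξ z 1 + (w.im : ℂ) • fderiv ℝ ξ z Complex.I := by
      have : w = w.re • (1 : ℂ) + w.im • Complex.I := by simp [Complex.re_add_im]
      conv_lhs => rw [this]
      rw [map_add, map_smul, map_smul]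
      rfl
    rw [h1, dhol, dbar]
    have e1 : w = w.re + w.im * Complex.I := (Complex.re_add_im w).symm
    have e2 : (starRingEnd ℂ) w = w.re - w.im * Complex.I := by
      apply Complex.ext <;> simp
    rw [e2]
    nth_rw 3 [e1]
    have hI : Complex.I * Complex.I = -1 := Complex.I_mul_I
    generalize fderiv ℝ ξ z 1 = a
    generalize fderiv ℝ ξ z Complex.I = b
    ext i
    simp only [PiLp.add_apply, PiLp.smul_apply, PiLp.sub_apply, smul_eq_mul]
    linear_combination (w.im : ℂ) * b i * hI
  rw [hw]
  refine (norm_add_le _ _).trans (le_of_eq ?_)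
  rw [norm_smul, norm_smul, RCLike.norm_conj]
  ring

lemma IsTest.continuous_dhol {η : ℂ → EuclideanSpace ℂ (Fin k)} (hη : IsTest η) :
    Continuous (dhol η) :=
  ((hη.dirD 1).continuous.sub ((hη.dirD Complex.I).continuous.const_smul
    Complex.I)).const_smul (2 : ℂ)⁻¹

lemma IsTest.continuous_dbar {η : ℂ → EuclideanSpace ℂ (Fin k)} (hη : IsTest η) :
    Continuous (dbar η) :=
  ((hη.dirD 1).continuous.add ((hη.dirD Complex.I).continuous.const_smul
    Complex.I)).const_smul (2 : ℂ)⁻¹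

/-- The Calderón–Zygmund inequality for `∂̄` on test functions. -/
lemma exists_eLpNorm_fderiv_le_dbar {p : ℝ} (hp : 2 ≤ p) :
    ∃ C : ENNReal, C ≠ ⊤ ∧ ∀ (k : ℕ) (η : ℂ → EuclideanSpace ℂ (Fin k)), IsTest η →
      eLpNorm (fun z => fderiv ℝ η z) (ENNReal.ofReal p) volume ≤
        C * eLpNorm (dbar η) (ENNReal.ofReal p) volume := by
  obtain ⟨C, hC0, hC⟩ := exists_dhol_lintegral_le hp
  have hp0 : 0 < p := by linarith
  have hpt : (ENNReal.ofReal p).toReal = p := ENNReal.toReal_ofReal hp0.le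
  refine ⟨ENNReal.ofReal C ^ (1 / p) + 1, ?_, fun k η hη => ?_⟩
  · exact ENNReal.add_ne_top.2 ⟨ENNReal.rpow_ne_top_of_nonneg (by positivity)
      ENNReal.ofReal_ne_top, ENNReal.one_ne_top⟩
  have h1 : eLpNorm (dhol η) (ENNReal.ofReal p) volume ≤
      ENNReal.ofReal C ^ (1 / p) * eLpNorm (dbar η) (ENNReal.ofReal p) volume := by
    rw [eLpNorm_eq_lintegral_rpow_enorm_toReal (by simpa using hp0) ENNReal.ofReal_ne_top,
      eLpNorm_eq_lintegral_rpow_enorm_toReal (by simpa using hp0) ENNReal.ofReal_ne_top, hpt,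
      ← ENNReal.mul_rpow_of_nonneg _ _ (by positivity)]
    exact ENNReal.rpow_le_rpow (hC k η hη) (by positivity)
  have m1 := hη.continuous_dhol.aestronglyMeasurable (μ := volume)
  have m2 := hη.continuous_dbar.aestronglyMeasurable (μ := volume)
  calc eLpNorm (fun z => fderiv ℝ η z) (ENNReal.ofReal p) volume
      ≤ eLpNorm ((fun z => ‖dhol η z‖) + fun z => ‖dbar η z‖) (ENNReal.ofReal p) volume :=
        eLpNorm_mono_real fun z => norm_fderiv_le_dhol_add_dbar η z
    _ ≤ eLpNorm (dhol η) (ENNReal.ofReal p) volume +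
        eLpNorm (dbar η) (ENNReal.ofReal p) volume := by
        refine (eLpNorm_add_le m1.norm m2.norm ?_).trans (by rw [eLpNorm_norm, eLpNorm_norm])
        exact ENNReal.one_le_ofReal.2 (by linarith)
    _ ≤ _ := by
        rw [add_mul, one_mul]
        gcongr

end

/-- Interior estimate for `∂̄` with the function itself on the right-hand side. -/
lemma exists_eLpNorm_fderiv_le_local {U K : Set ℂ} (hU : IsOpen U) (hK : IsCompact K)
    (hKU : K ⊆ U) {p : ℝ} (hp : 2 ≤ p) :
    ∃ S, IsCompact S ∧ S ⊆ U ∧ ∃ C : ENNReal, C ≠ ⊤ ∧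
      ∀ (k : ℕ) (ξ : ℂ → EuclideanSpace ℂ (Fin k)), ContDiffOn ℝ (⊤ : ℕ∞) ξ U →
        eLpNorm (fun z => fderiv ℝ ξ z) (ENNReal.ofReal p) (volume.restrict K) ≤
          C * (eLpNorm (dbar ξ) (ENNReal.ofReal p) (volume.restrict S) +
            eLpNorm ξ (ENNReal.ofReal p) (volume.restrict S)) := by
  obtain ⟨χ, hχ, hχU, hχK, hχ1⟩ := exists_smooth_cutoff hK hU hKU
  obtain ⟨B, hB⟩ := hχ.fderiv.compact.exists_bound_of_continuous hχ.fderiv.continuous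
  have hB0 : 0 ≤ B := (norm_nonneg _).trans (hB 0)
  obtain ⟨C, hC, H⟩ := exists_eLpNorm_fderiv_le_dbar hp
  refine ⟨tsupport χ, hχ.compact, hχU, C * ENNReal.ofReal (1 + B),
    ENNReal.mul_ne_top hC ENNReal.ofReal_ne_top, fun k ξ hξ => ?_⟩
  have hη := hχ.smul_of_contDiffOn hU hχU hξ
  obtain ⟨m1, m2⟩ := aestronglyMeasurable_of_contDiffOn hU hξ hχ.compact hχU
  have m3 : AEStronglyMeasurable (dbar ξ) (volume.restrict (tsupport χ)) := by
    have a1 := m2.apply_continuousLinearMap (1 : ℂ)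
    have a2 := m2.apply_continuousLinearMap Complex.I
    exact (a1.add (a2.const_smul Complex.I)).const_smul (2 : ℂ)⁻¹
  have hd := eLpNorm_le_of_norm_le_add (f := dbar fun z => χ z • ξ z) (q := ENNReal.ofReal p)
    (M := 1 + B) hχ.compact.measurableSet (by positivity)
    (ENNReal.one_le_ofReal.2 (by linarith)) m3 m1
    (fun x hx => by
      have e : dbar (fun z => χ z • ξ z) x = χ x • dbar ξ x +
          (2 : ℂ)⁻¹ • (fderiv ℝ χ x 1 • ξ x + Complex.I • fderiv ℝ χ x Complex.I • ξ x) := by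
        simp only [dbar]
        rw [fderiv_smul_of_contDiffOn hχ hU hξ (hχU hx)]
        ext i
        simp
        ring
      have b1 : ‖χ x • dbar ξ x‖ ≤ ‖dbar ξ x‖ := by
        rw [norm_smul]
        exact mul_le_of_le_one_left (norm_nonneg _) (hχ1 x)
      have b2 (e : ℂ) (he : ‖e‖ = 1) : ‖fderiv ℝ χ x e • ξ x‖ ≤ B * ‖ξ x‖ := by
        rw [norm_smul]
        gcongr
        refine ((fderiv ℝ χ x).le_opNorm e).trans ?_
        rw [he, mul_one]
        exact hB x
      have b4 : ‖Complex.I • fderiv ℝ χ x Complex.I • ξ x‖ ≤ B * ‖ξ x‖ := by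
        rw [norm_smul, Complex.norm_I, one_mul]
        exact b2 Complex.I Complex.norm_I
      have b3 : ‖(2 : ℂ)⁻¹ • (fderiv ℝ χ x 1 • ξ x + Complex.I • fderiv ℝ χ x Complex.I • ξ x)‖
          ≤ B * ‖ξ x‖ := by
        rw [norm_smul]
        have := (norm_add_le (fderiv ℝ χ x 1 • ξ x)
          (Complex.I • fderiv ℝ χ x Complex.I • ξ x)).trans
          (add_le_add (b2 1 (by simp)) b4)
        rw [norm_inv, Complex.norm_ofNat]
        linarith
      rw [e]
      refine (norm_add_le _ _).trans ((add_le_add b1 b3).trans ?_)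
      nlinarith [norm_nonneg (ξ x), mul_nonneg hB0 (norm_nonneg (dbar ξ x))])
    (fun x hx => by simp [dbar, fderiv_smul_eq_zero hx])
  calc eLpNorm (fun z => fderiv ℝ ξ z) (ENNReal.ofReal p) (volume.restrict K)
      = eLpNorm (fun z => fderiv ℝ (fun z => χ z • ξ z) z) (ENNReal.ofReal p)
          (volume.restrict K) := by
        refine eLpNorm_congr_ae ((ae_restrict_iff' hK.measurableSet).2
          (Filter.Eventually.of_forall fun z hz => ?_))
        refine Filter.EventuallyEq.fderiv_eq ?_
        filter_upwards [hχK z hz] with w hw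
        rw [hw, one_smul]
    _ ≤ eLpNorm (fun z => fderiv ℝ (fun z => χ z • ξ z) z) (ENNReal.ofReal p) volume :=
        eLpNorm_mono_measure _ Measure.restrict_le_self
    _ ≤ _ := (H k _ hη).trans (by rw [mul_assoc]; gcongr)

/-- Interior estimate for `∂̄` on a compact subset of an open set. -/
lemma exists_interior_estimate {U K : Set ℂ} (hU : IsOpen U) (hK : IsCompact K)
    (hKU : K ⊆ U) {p : ℝ} (hp : 1 ≤ p) :
    ∃ C : ENNReal, C ≠ ⊤ ∧
      ∀ (k : ℕ) (ξ : ℂ → EuclideanSpace ℂ (Fin k)), ContDiffOn ℝ (⊤ : ℕ∞) ξ U →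
        eLpNorm ξ (ENNReal.ofReal p) (volume.restrict K) +
          eLpNorm (fun z => fderiv ℝ ξ z) (ENNReal.ofReal p) (volume.restrict K) ≤
        C * (eLpNorm (dbar ξ) (ENNReal.ofReal p) (volume.restrict U) +
          eLpNorm (fun z => fderiv ℝ ξ z) 2 (volume.restrict U) +
          eLpNorm ξ 1 (volume.restrict U)) := by
  have hp' : 1 ≤ ENNReal.ofReal p := ENNReal.one_le_ofReal.2 hp
  obtain ⟨C₁, hC₁, H₁⟩ := exists_eLpNorm_le_of_fderiv_two hU hK hKU hp' ENNReal.ofReal_ne_top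
  rcases le_total p 2 with h2 | h2
  · have : IsFiniteMeasure (volume.restrict K) := ⟨by simpa using hK.measure_lt_top⟩
    obtain ⟨A, hA, HA⟩ := exists_eLpNorm_le_of_exponent_le (volume.restrict K)
      (p := ENNReal.ofReal p) (q := 2) hp' (by simpa using ENNReal.ofReal_le_ofReal h2)
      (by norm_num)
    refine ⟨C₁ + A, by finiteness, fun k ξ hξ => ?_⟩
    have mK := aestronglyMeasurable_of_contDiffOn hU hξ hK hKU
    have hX : eLpNorm (fun z => fderiv ℝ ξ z) 2 (volume.restrict K) ≤
        eLpNorm (fun z => fderiv ℝ ξ z) 2 (volume.restrict U) :=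
      eLpNorm_mono_measure _ (Measure.restrict_mono hKU le_rfl)
    have h1 := H₁ k ξ hξ
    have h3 := (HA _ _ _ mK.2).trans (mul_le_mul_right hX A)
    set X := eLpNorm (fun z => fderiv ℝ ξ z) 2 (volume.restrict U)
    set Y := eLpNorm ξ 1 (volume.restrict U)
    set Z := eLpNorm (dbar ξ) (ENNReal.ofReal p) (volume.restrict U)
    calc _ ≤ C₁ * (X + Y) + A * X := add_le_add h1 h3
      _ ≤ C₁ * (X + Y) + A * X + (A * Y + (C₁ + A) * Z) := le_self_add
      _ = _ := by ring
  · obtain ⟨S, hS, hSU, C₂, hC₂, H₂⟩ := exists_eLpNorm_fderiv_le_local hU hK hKU h2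
    obtain ⟨C₃, hC₃, H₃⟩ := exists_eLpNorm_le_of_fderiv_two hU hS hSU hp' ENNReal.ofReal_ne_top
    refine ⟨C₁ + C₂ * (1 + C₃), by finiteness, fun k ξ hξ => ?_⟩
    have hZ : eLpNorm (dbar ξ) (ENNReal.ofReal p) (volume.restrict S) ≤
        eLpNorm (dbar ξ) (ENNReal.ofReal p) (volume.restrict U) :=
      eLpNorm_mono_measure _ (Measure.restrict_mono hSU le_rfl)
    have h1 := H₁ k ξ hξ
    have h3 := (H₂ k ξ hξ).trans (mul_le_mul_right (add_le_add hZ (H₃ k ξ hξ)) C₂)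
    set X := eLpNorm (fun z => fderiv ℝ ξ z) 2 (volume.restrict U)
    set Y := eLpNorm ξ 1 (volume.restrict U)
    set Z := eLpNorm (dbar ξ) (ENNReal.ofReal p) (volume.restrict U)
    calc _ ≤ C₁ * (X + Y) + C₂ * (Z + C₃ * (X + Y)) := add_le_add h1 h3
      _ ≤ C₁ * (X + Y) + C₂ * (Z + C₃ * (X + Y)) +
          (C₁ * Z + C₂ * (X + Y) + C₂ * (C₃ * Z)) := le_self_add
      _ = _ := by ring

/-- **Interior elliptic estimate for `∂̄` on annuli (`L^p_1`-version).** For any `δ > 0`,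
`p ≥ 1`, and open annulus `A₁ = B_{R₁,r₁}`, there is `C > 0` such that for every closed
annulus `A₂ = closure(B_{R₂}) \ B_{r₂}` with `R₁ − R₂ > δ` and `r₂ − r₁ ≥ δ`, and every
smooth `ξ : A₁ → ℂ^k`:
`‖ξ‖_{L^p(A₂)} + ‖dξ‖_{L^p(A₂)} ≤ C (‖∂̄ξ‖_{L^p(A₁)} + ‖dξ‖_{L²(A₁)} + ‖ξ‖_{L¹(A₁)})`. -/
theorem stmt10 (δ p : ℝ) (hδ : 0 < δ) (hp : 1 ≤ p)
    (R₁ r₁ : ℝ) (hR₁ : 0 < R₁) (hr₁ : r₁ ∈ Set.Ico 0 R₁) :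
    ∃ C : ℝ, 0 < C ∧
      ∀ (k : ℕ) (R₂ r₂ : ℝ), δ < R₁ - R₂ → δ ≤ r₂ - r₁ →
        ∀ ξ : ℂ → EuclideanSpace ℂ (Fin k),
          ContDiffOn ℝ (⊤ : ℕ∞) ξ (cAnnulus R₁ r₁) →
          eLpNorm ξ (ENNReal.ofReal p) (volume.restrict (cClosedAnnulus R₂ r₂)) +
            eLpNorm (fun z => fderiv ℝ ξ z) (ENNReal.ofReal p)
              (volume.restrict (cClosedAnnulus R₂ r₂)) ≤
          ENNReal.ofReal C *
            (eLpNorm (dbar ξ) (ENNReal.ofReal p) (volume.restrict (cAnnulus R₁ r₁)) +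
              eLpNorm (fun z => fderiv ℝ ξ z) 2 (volume.restrict (cAnnulus R₁ r₁)) +
              eLpNorm ξ 1 (volume.restrict (cAnnulus R₁ r₁))) := by
  have hδU : cClosedAnnulus (R₁ - δ) (r₁ + δ) ⊆ cAnnulus R₁ r₁ := by
    rintro z ⟨h1, h2⟩
    refine ⟨?_, fun h3 => ?_⟩
    · rw [mem_closedBall_zero_iff] at h1
      rw [mem_ball_zero_iff]
      linarith
    · have h4 := Metric.closure_ball_subset_closedBall h3
      rw [mem_closedBall_zero_iff] at h4
      rw [mem_ball_zero_iff] at h2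
      linarith
  have hU : IsOpen (cAnnulus R₁ r₁) := Metric.isOpen_ball.sdiff isClosed_closure
  have hK : IsCompact (cClosedAnnulus (R₁ - δ) (r₁ + δ)) :=
    (isCompact_closedBall 0 _).diff Metric.isOpen_ball
  obtain ⟨C, hC, h⟩ := exists_interior_estimate hU hK hδU hp
  refine ⟨C.toReal + 1, by positivity, fun k R₂ r₂ hR hr ξ hξ => ?_⟩
  have hsub : cClosedAnnulus R₂ r₂ ⊆ cClosedAnnulus (R₁ - δ) (r₁ + δ) :=
    Set.sdiff_subset_sdiff (Metric.closedBall_subset_closedBall (by linarith))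
      (Metric.ball_subset_ball (by linarith))
  have hCC : C ≤ ENNReal.ofReal (C.toReal + 1) := by
    conv_lhs => rw [← ENNReal.ofReal_toReal hC]
    exact ENNReal.ofReal_le_ofReal (by linarith)
  exact (add_le_add (eLpNorm_mono_measure _ (Measure.restrict_mono hsub le_rfl))
    (eLpNorm_mono_measure _ (Measure.restrict_mono hsub le_rfl))).trans
    ((h k ξ hξ).trans (by gcongr))
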